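/- arXiv:1302.2486 — 5 statements merged into one kernel-verified Lean document; each statement's English description precedes it below -/
import Mathlib

section
/- Let T be the doubling map and 0 < a < b < 1. If a < 1/4 and b > 1/2, or if a < 1/2 and b > 3/4, then 𝒥(a,b) = {0,1}. -/
noncomputable section

/-- The doubling map. -/
def Dbl (x : ℝ) : ℝ := if x ≤ 1/2 then 2*x else 2*x - 1

/-- Survivor set `𝒥(a,b)`. -/
def J (a b : ℝ) : Set ℝ := {x ∈ Set.Icc (0:ℝ) 1 | ∀ n : ℕ, Dbl^[n] x ∉ Set.Ioo a b}

/-- The shift on binary sequences. -/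
def shft (x : ℕ → Bool) : ℕ → Bool := fun n => x (n+1)

/-- Binary expansion value. -/
def piMap (w : ℕ → Bool) : ℝ := ∑' n : ℕ, (if w n then (1:ℝ) else 0) / 2 ^ (n+1)

/-- Strict lexicographic order on binary sequences. -/
def seqLt (u v : ℕ → Bool) : Prop := ∃ n, (∀ i < n, u i = v i) ∧ u n < v n

def seqLe (u v : ℕ → Bool) : Prop := seqLt u v ∨ u = v

/-- Periodic sequence `w^∞` associated with a finite word. -/
def per (w : List Bool) : ℕ → Bool := fun n => w.getD (n % w.length) false

/-- Concatenation of a finite word and an infinite sequence. -/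
def cat (w : List Bool) (x : ℕ → Bool) : ℕ → Bool :=
  fun n => if n < w.length then w.getD n false else x (n - w.length)

/-- A finite word is balanced. -/
def BalancedWord (l : List Bool) : Prop :=
  ∀ u v : List Bool, u <:+: l → v <:+: l → u.length = v.length →
    (u.count true : ℤ) - (v.count true : ℤ) ≤ 1

/-- A finite word is cyclically balanced. -/
def CycBalanced (w : List Bool) : Prop := BalancedWord (w ++ w)

def OmegaSet (r : ℚ) (b : Bool) : Set (List Bool) :=
  {w | w.length = r.den ∧ w.count true = r.num.toNat ∧ CycBalanced w ∧ w.head? = some b}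

/-- `w` is the lexicographically largest cyclically balanced word of length `q`
with `p` ones beginning with 0, where `r = p/q` in lowest terms. -/
def IsOmegaMinus (r : ℚ) (w : List Bool) : Prop :=
  w ∈ OmegaSet r false ∧ ∀ v ∈ OmegaSet r false, v = w ∨ List.Lex (· < ·) v w

/-- `w` is the lexicographically smallest cyclically balanced word of length `q`
with `p` ones beginning with 1. -/
def IsOmegaPlus (r : ℚ) (w : List Bool) : Prop :=
  w ∈ OmegaSet r true ∧ ∀ v ∈ OmegaSet r true, v = w ∨ List.Lex (· < ·) w v

open Classical in
def omegaMinus (r : ℚ) : List Bool :=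
  if h : ∃ w, IsOmegaMinus r w then h.choose else []

open Classical in
def omegaPlus (r : ℚ) : List Bool :=
  if h : ∃ w, IsOmegaPlus r w then h.choose else []

/-- The substitution `ρ_r` applied to a word. -/
def substR (r : ℚ) (w : List Bool) : List Bool :=
  (w.map (fun b => if b then omegaPlus r else omegaMinus r)).flatten

/-- `s_n = ρ_{r_1}∘⋯∘ρ_{r_n}(0)`. -/
def sWord : List ℚ → List Bool
  | [] => [false]
  | r :: rs => substR r (sWord rs)

/-- `t_n = ρ_{r_1}∘⋯∘ρ_{r_n}(1)`. -/
def tWord : List ℚ → List Bool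
  | [] => [true]
  | r :: rs => substR r (tWord rs)

/-- `Δ(r_1,…,r_n) = [π(s_n^∞), π(s_n t_n^∞)]`. -/
def DeltaI (rs : List ℚ) : Set ℝ :=
  Set.Icc (piMap (per (sWord rs))) (piMap (cat (sWord rs) (per (tWord rs))))

/-- `Δ̃(r_1,…,r_n) = [π(s_n t_n s_n^∞), π(s_n t_n^∞)]`. -/
def DeltaTilde (rs : List ℚ) : Set ℝ :=
  Set.Icc (piMap (cat (sWord rs) (cat (tWord rs) (per (sWord rs)))))
    (piMap (cat (sWord rs) (per (tWord rs))))

/-- The exceptional set `𝒮`. -/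
def Scal : Set ℝ :=
  Set.Ioo (1/4 : ℝ) (1/2) \ ⋃ r ∈ {r : ℚ | 0 < r ∧ r < 1}, DeltaI [r]

/-- `φ(a)`. -/
def phi (a : ℝ) : ℝ := sSup {b | b ∈ Set.Ioo a 1 ∧ J a b ≠ ({0, 1} : Set ℝ)}

/-- `χ(a)`. -/
def chi (a : ℝ) : ℝ := sSup {b | b ∈ Set.Ioo a 1 ∧ ¬ (J a b).Countable}

/-- `s_n` built from the first `m` entries of an infinite sequence of rationals. -/
def sWordN (r : ℕ → ℚ) (m : ℕ) : List Bool := sWord (List.ofFn fun i : Fin m => r i)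

def tWordN (r : ℕ → ℚ) (m : ℕ) : List Bool := tWord (List.ofFn fun i : Fin m => r i)

/-- `𝔰(𝐫)`, the coordinatewise limit of `ρ_{r_1}⋯ρ_{r_n}(0)`. -/
def sLim (r : ℕ → ℚ) : ℕ → Bool := fun k => (sWordN r (k+1)).getD k false

/-- `𝔱(𝐫)`. -/
def tLim (r : ℕ → ℚ) : ℕ → Bool := fun k => (tWordN r (k+1)).getD k false

lemma aux_low (n : ℕ) : ∀ x : ℝ, 0 < x → x ≤ 1/2 → 1/4 < 2^n * x →
    ∃ k : ℕ, 1/4 < Dbl^[k] x ∧ Dbl^[k] x ≤ 1/2 := by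
  induction n with
  | zero =>
    intro x _ h2 h3
    exact ⟨0, by simpa using h3, by simpa using h2⟩
  | succ n ih =>
    intro x h1 h2 h3
    by_cases hx : 1/4 < x
    · exact ⟨0, by simpa using hx, by simpa using h2⟩
    · push Not at hx
      have hD : Dbl x = 2*x := by unfold Dbl; rw [if_pos h2]
      obtain ⟨k, hk⟩ := ih (2*x) (by linarith) (by linarith)
        (by rw [pow_succ] at h3; linarith)
      refine ⟨k+1, ?_⟩
      rw [Function.iterate_succ_apply, hD]
      exact hk

lemma aux_high (n : ℕ) : ∀ x : ℝ, 1/2 < x → x < 1 → 1/4 ≤ 2^n * (1-x) →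
    ∃ k : ℕ, 1/2 < Dbl^[k] x ∧ Dbl^[k] x ≤ 3/4 := by
  induction n with
  | zero =>
    intro x h1 _ h3
    refine ⟨0, ?_, ?_⟩
    · simpa using h1
    · simp only [pow_zero, Function.iterate_zero, id] at *
      linarith
  | succ n ih =>
    intro x h1 h2 h3
    by_cases hx : x ≤ 3/4
    · exact ⟨0, by simpa using h1, by simpa using hx⟩
    · push Not at hx
      have hD : Dbl x = 2*x-1 := by unfold Dbl; rw [if_neg (by linarith)]
      obtain ⟨k, hk⟩ := ih (2*x-1) (by linarith) (by linarith)
        (by rw [pow_succ] at h3; linarith)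
      refine ⟨k+1, ?_⟩
      rw [Function.iterate_succ_apply, hD]
      exact hk

lemma exists_low (x : ℝ) (h1 : 0 < x) (h2 : x ≤ 1/2) :
    ∃ k : ℕ, 1/4 < Dbl^[k] x ∧ Dbl^[k] x ≤ 1/2 := by
  obtain ⟨n, hn⟩ := pow_unbounded_of_one_lt (1/4/x) (one_lt_two (α := ℝ))
  exact aux_low n x h1 h2 ((div_lt_iff₀ h1).1 hn)

lemma exists_high (x : ℝ) (h1 : 1/2 < x) (h2 : x < 1) :
    ∃ k : ℕ, 1/2 < Dbl^[k] x ∧ Dbl^[k] x ≤ 3/4 := by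
  obtain ⟨n, hn⟩ := pow_unbounded_of_one_lt (1/4/(1-x)) (one_lt_two (α := ℝ))
  exact aux_high n x h1 h2 ((div_lt_iff₀ (by linarith)).1 hn).le

theorem stmt0 (a b : ℝ) (ha : 0 < a) (hab : a < b) (hb : b < 1)
    (h : (a < 1/4 ∧ 1/2 < b) ∨ (a < 1/2 ∧ 3/4 < b)) :
    J a b = ({0, 1} : Set ℝ) := by
  have hJ : ∀ (x : ℝ) (k : ℕ), (∀ n : ℕ, Dbl^[n] x ∉ Set.Ioo a b) →
      ∀ n : ℕ, Dbl^[n] (Dbl^[k] x) ∉ Set.Ioo a b := by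
    intro x k hx n
    rw [← Function.iterate_add_apply]
    exact hx _
  have hfix0 : Dbl 0 = 0 := by norm_num [Dbl]
  have hfix1 : Dbl 1 = 1 := by norm_num [Dbl]
  ext x
  simp only [Set.mem_insert_iff, Set.mem_singleton_iff]
  constructor
  · rintro ⟨⟨hx0, hx1⟩, hx⟩
    by_contra hne
    push Not at hne
    have h0 : 0 < x := lt_of_le_of_ne hx0 (Ne.symm hne.1)
    have h1 : x < 1 := lt_of_le_of_ne hx1 hne.2
    rcases h with ⟨ha4, hb2⟩ | ⟨ha2, hb4⟩
    · have key : ∀ y : ℝ, 0 < y → y ≤ 1/2 →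
          (∀ n : ℕ, Dbl^[n] y ∉ Set.Ioo a b) → False := by
        intro y hy1 hy2 hy
        obtain ⟨k, hk1, hk2⟩ := exists_low y hy1 hy2
        exact hy k ⟨by linarith, by linarith⟩
      by_cases hx2 : x ≤ 1/2
      · exact key x h0 hx2 hx
      · push Not at hx2
        obtain ⟨k, hk1, hk2⟩ := exists_high x hx2 h1
        have hD : Dbl (Dbl^[k] x) = 2 * (Dbl^[k] x) - 1 := by
          rw [Dbl, if_neg (by linarith)]
        refine key (Dbl^[k+1] x) ?_ ?_ (hJ x (k+1) hx) <;>
          rw [Function.iterate_succ_apply', hD] <;> linarith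
    · have key : ∀ y : ℝ, 1/2 < y → y < 1 →
          (∀ n : ℕ, Dbl^[n] y ∉ Set.Ioo a b) → False := by
        intro y hy1 hy2 hy
        obtain ⟨k, hk1, hk2⟩ := exists_high y hy1 hy2
        exact hy k ⟨by linarith, by linarith⟩
      by_cases hx2 : x ≤ 1/2
      · obtain ⟨k, hk1, hk2⟩ := exists_low x h0 hx2
        have hk3 : Dbl^[k] x < 1/2 := by
          refine lt_of_le_of_ne hk2 fun he => hx k ?_
          rw [he]
          exact ⟨by linarith, by linarith⟩
        have hD : Dbl (Dbl^[k] x) = 2 * (Dbl^[k] x) := by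
          rw [Dbl, if_pos hk2]
        refine key (Dbl^[k+1] x) ?_ ?_ (hJ x (k+1) hx) <;>
          rw [Function.iterate_succ_apply', hD] <;> linarith
      · exact key x (by linarith) h1 hx
  · rintro (rfl | rfl)
    · refine ⟨⟨le_rfl, zero_le_one⟩, fun n hn => ?_⟩
      rw [Function.iterate_fixed hfix0] at hn
      exact absurd hn.1 (by linarith)
    · refine ⟨⟨zero_le_one, le_rfl⟩, fun n hn => ?_⟩
      rw [Function.iterate_fixed hfix1] at hn
      exact absurd hn.2 (by linarith)


end
end

section
/- Let T be the doubling map and 0 < a < b < 1. If b < 1/2 or a > 1/2, then dim_H 𝒥(a,b) > 0. -/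
noncomputable section

/-- Sum of digits with ratio `c`. -/
def SS (c : ℝ) (w : ℕ → Bool) : ℝ := ∑' n : ℕ, (if w n then (1:ℝ) else 0) * (c ^ n / 2)

lemma SS_summable {c : ℝ} (h0 : 0 ≤ c) (h1 : c ≤ 1/2) (w : ℕ → Bool) :
    Summable (fun n : ℕ => (if w n then (1:ℝ) else 0) * (c ^ n / 2)) := by
  have hg : Summable (fun n : ℕ => c ^ n / 2) :=
    (summable_geometric_of_lt_one h0 (by linarith)).div_const 2
  refine Summable.of_nonneg_of_le (fun n => ?_) (fun n => ?_) hg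
  · split_ifs <;> positivity
  · have : 0 ≤ c ^ n / 2 := by positivity
    split_ifs <;> linarith

lemma SS_nonneg {c : ℝ} (h0 : 0 ≤ c) (w : ℕ → Bool) : 0 ≤ SS c w := by
  refine tsum_nonneg (fun n => ?_)
  split_ifs <;> positivity

lemma SS_le_one {c : ℝ} (h0 : 0 ≤ c) (h1 : c ≤ 1/2) (w : ℕ → Bool) : SS c w ≤ 1 := by
  have hg : Summable (fun n : ℕ => c ^ n / 2) :=
    (summable_geometric_of_lt_one h0 (by linarith)).div_const 2
  have h2 : SS c w ≤ ∑' n : ℕ, c ^ n / 2 := by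
    refine Summable.tsum_le_tsum (fun n => ?_) (SS_summable h0 h1 w) hg
    have : 0 ≤ c ^ n / 2 := by positivity
    split_ifs <;> linarith
  rw [tsum_div_const, tsum_geometric_of_lt_one h0 (by linarith)] at h2
  have h3 : (1 - c)⁻¹ ≤ 2 := by
    rw [inv_le_comm₀ (by linarith) (by norm_num)]
    linarith
  linarith

lemma SS_step {c : ℝ} (h0 : 0 ≤ c) (h1 : c ≤ 1/2) (w : ℕ → Bool) :
    SS c w = (if w 0 then (1:ℝ) else 0) / 2 + c * SS c (shft w) := by
  unfold SS
  rw [(SS_summable h0 h1 w).tsum_eq_zero_add, ← tsum_mul_left]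
  congr 1
  · simp [div_eq_mul_inv]
  · refine tsum_congr (fun n => ?_)
    simp only [shft, pow_succ]
    ring

lemma SS_upper {c : ℝ} (h0 : 0 ≤ c) (h1 : c ≤ 1/2) (n : ℕ) : ∀ (w v : ℕ → Bool),
    (∀ i < n, w i = v i) → |SS c w - SS c v| ≤ c ^ n := by
  induction n with
  | zero =>
    intro w v _
    have := SS_nonneg h0 w
    have := SS_nonneg h0 v
    have := SS_le_one h0 h1 w
    have := SS_le_one h0 h1 v
    rw [abs_le]
    constructor <;> simp <;> linarith
  | succ n ih =>
    intro w v h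
    have h2 := ih (shft w) (shft v) (fun i hi => h (i+1) (by omega))
    rw [SS_step h0 h1 w, SS_step h0 h1 v, h 0 (by omega)]
    have : ∀ t : ℝ, t + c * SS c (shft w) - (t + c * SS c (shft v))
      = c * (SS c (shft w) - SS c (shft v)) := fun t => by ring
    rw [this, abs_mul, abs_of_nonneg h0, pow_succ']
    gcongr

lemma SS_lower {c : ℝ} (h0 : 0 ≤ c) (h1 : c ≤ 1/4) (n : ℕ) : ∀ (w v : ℕ → Bool),
    (∀ i < n, w i = v i) → w n ≠ v n → c ^ n ≤ 4 * |SS c w - SS c v| := by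
  have h1' : c ≤ 1/2 := by linarith
  induction n with
  | zero =>
    intro w v _ hne
    rw [SS_step h0 h1' w, SS_step h0 h1' v]
    have a1 : 0 ≤ c * SS c (shft w) := mul_nonneg h0 (SS_nonneg h0 _)
    have a2 : 0 ≤ c * SS c (shft v) := mul_nonneg h0 (SS_nonneg h0 _)
    have a3 : c * SS c (shft w) ≤ 1/4 * 1 :=
      mul_le_mul h1 (SS_le_one h0 h1' _) (SS_nonneg h0 _) (by norm_num)
    have a4 : c * SS c (shft v) ≤ 1/4 * 1 :=
      mul_le_mul h1 (SS_le_one h0 h1' _) (SS_nonneg h0 _) (by norm_num)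
    generalize c * SS c (shft w) = x at *
    generalize c * SS c (shft v) = y at *
    rw [pow_zero]
    cases hw : w 0 <;> cases hv : v 0 <;> simp_all
    · have := neg_le_abs (x - (1 / 2 + y))
      norm_num at this ⊢
      linarith
    · have := le_abs_self (1 / 2 + x - y)
      norm_num at this ⊢
      linarith
  | succ n ih =>
    intro w v h hne
    have h2 := ih (shft w) (shft v) (fun i hi => h (i+1) (by omega)) hne
    rw [SS_step h0 h1' w, SS_step h0 h1' v, h 0 (by omega)]
    have : ∀ t : ℝ, t + c * SS c (shft w) - (t + c * SS c (shft v))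
      = c * (SS c (shft w) - SS c (shft v)) := fun t => by ring
    rw [this, abs_mul, abs_of_nonneg h0, pow_succ']
    have := mul_le_mul_of_nonneg_left h2 h0
    linarith

lemma SS_surj {x : ℝ} (hx : x ∈ Set.Icc (0:ℝ) 1) : ∃ w, SS (1/2) w = x := by
  obtain ⟨d, -, hd⟩ := Real.ofDigits_SurjOn (b := 2) (by norm_num) hx
  refine ⟨fun n => decide (d n = 1), ?_⟩
  rw [← hd]
  unfold SS Real.ofDigits Real.ofDigitsTerm
  refine tsum_congr (fun n => ?_)
  have : d n = 0 ∨ d n = 1 := by omega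
  rcases this with h | h <;> simp [h, pow_succ, mul_comm, div_eq_mul_inv]

lemma SS_holder {L : ℕ} (hL : 2 ≤ L) (w v : ℕ → Bool) :
    |SS (1/2) w - SS (1/2) v| ≤ 4 * |SS ((1/2)^L) w - SS ((1/2)^L) v| ^ ((1:ℝ)/L) := by
  by_cases hwv : w = v
  · subst hwv
    simp only [sub_self, abs_zero]
    positivity
  have hex : ∃ n, w n ≠ v n := by
    by_contra hcon
    push Not at hcon
    exact hwv (funext hcon)
  classical
  have hmin : ∀ i < Nat.find hex, w i = v i := fun i hi => by
    have := Nat.find_min hex hi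
    simpa using this
  have hsp := Nat.find_spec hex
  generalize Nat.find hex = n at *
  have hc : ((1:ℝ)/2)^L ≤ 1/4 := by
    calc ((1:ℝ)/2)^L ≤ (1/2)^2 := pow_le_pow_of_le_one (by norm_num) (by norm_num) hL
      _ = 1/4 := by norm_num
  have h1 := SS_upper (c := 1/2) (by norm_num) le_rfl n w v hmin
  have h2 := SS_lower (c := (1/2)^L) (by positivity) hc n w v hmin hsp
  have hL0 : (L:ℝ) ≠ 0 := by positivity
  have h3 : ((1:ℝ)/2)^n = ((((1:ℝ)/2)^L)^n) ^ ((1:ℝ)/L) := by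
    rw [← pow_mul, mul_comm, pow_mul, one_div (L:ℝ), Real.pow_rpow_inv_natCast (by positivity)
      (by omega)]
  calc |SS (1/2) w - SS (1/2) v| ≤ (1/2)^n := h1
    _ = ((((1:ℝ)/2)^L)^n) ^ ((1:ℝ)/L) := h3
    _ ≤ (4 * |SS ((1/2)^L) w - SS ((1/2)^L) v|) ^ ((1:ℝ)/L) :=
        Real.rpow_le_rpow (by positivity) h2 (by positivity)
    _ = 4 ^ ((1:ℝ)/L) * |SS ((1/2)^L) w - SS ((1/2)^L) v| ^ ((1:ℝ)/L) :=
        Real.mul_rpow (by norm_num) (abs_nonneg _)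
    _ ≤ 4 * |SS ((1/2)^L) w - SS ((1/2)^L) v| ^ ((1:ℝ)/L) := by
        gcongr
        calc (4:ℝ) ^ ((1:ℝ)/L) ≤ 4 ^ (1:ℝ) := by
              apply Real.rpow_le_rpow_of_exponent_le (by norm_num)
              rw [div_le_one (by positivity)]
              exact_mod_cast (by omega : 1 ≤ L)
          _ = 4 := by norm_num

lemma dimH_SS_pos {L : ℕ} (hL : 2 ≤ L) : 0 < dimH (Set.range (SS ((1/2)^L))) := by
  set f : ℝ → ℝ := fun x => SS (1/2) (Function.invFun (SS ((1/2)^L)) x) with hf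
  have hLpos : (0:ℝ) < L := by positivity
  have hol : HolderOnWith 4 (1/(L:NNReal)) f (Set.range (SS ((1/2)^L))) := by
    intro x hx y hy
    have h := SS_holder hL (Function.invFun (SS ((1/2)^L)) x) (Function.invFun (SS ((1/2)^L)) y)
    rw [Function.invFun_eq hx, Function.invFun_eq hy] at h
    rw [edist_dist, edist_dist, ENNReal.ofReal_rpow_of_nonneg dist_nonneg (by positivity),
      ← ENNReal.ofReal_coe_nnreal, ← ENNReal.ofReal_mul (by positivity)]
    apply ENNReal.ofReal_le_ofReal
    simpa [Real.dist_eq, hf] using h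
  have himg : Set.Icc (0:ℝ) 1 ⊆ f '' (Set.range (SS ((1/2)^L))) := by
    intro x hx
    obtain ⟨w, hw⟩ := SS_surj hx
    refine ⟨_, ⟨w, rfl⟩, ?_⟩
    have h := SS_holder hL (Function.invFun (SS ((1/2)^L)) (SS ((1/2)^L) w)) w
    rw [Function.invFun_eq (f := SS ((1/2)^L)) ⟨w, rfl⟩, sub_self, abs_zero, Real.zero_rpow (by positivity),
      mul_zero, abs_nonpos_iff, sub_eq_zero] at h
    rw [hf, ← hw]
    exact h
  have h1 : dimH (Set.Icc (0:ℝ) 1) = 1 := by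
    have := Real.dimH_of_nonempty_interior (E := ℝ) (s := Set.Icc (0:ℝ) 1) (by
      rw [interior_Icc]; exact ⟨1/2, by norm_num, by norm_num⟩)
    simpa using this
  have h2 := (dimH_mono himg).trans (hol.dimH_image_le (by positivity))
  rw [h1] at h2
  by_contra hcon
  have h0 : dimH (Set.range (SS ((1/2)^L))) = 0 := by simpa using hcon
  rw [h0] at h2
  simp at h2

/-- The invariant set. -/
def PP (L : ℕ) : Set ℝ :=
  {x | x = 0 ∨ x = 1 ∨ ∃ i < L, ∃ w, x = (1/2)^i * SS ((1/2)^L) w}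

lemma pow_bound {L : ℕ} (hL : 2 ≤ L) : ((1:ℝ)/2)^L ≤ 1/2 := by
  calc ((1:ℝ)/2)^L ≤ (1/2)^1 := pow_le_pow_of_le_one (by norm_num) (by norm_num) (by omega)
    _ = 1/2 := by norm_num

lemma PP_range {L : ℕ} (hL : 2 ≤ L) (w) : SS ((1/2)^L) w ∈ PP L :=
  Or.inr (Or.inr ⟨0, by omega, w, by simp⟩)

lemma PP_Icc {L : ℕ} (hL : 2 ≤ L) {x : ℝ} (hx : x ∈ PP L) : 0 ≤ x ∧ x ≤ 1 := by
  rcases hx with rfl | rfl | ⟨i, hi, w, rfl⟩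
  · simp
  · simp
  · have h0 := SS_nonneg (c := (1/2)^L) (by positivity) w
    have h1 := SS_le_one (c := (1/2)^L) (by positivity) (pow_bound hL) w
    exact ⟨by positivity, mul_le_one₀ (pow_le_one₀ (by norm_num) (by norm_num)) h0 h1⟩

lemma PP_bound {L : ℕ} (hL : 2 ≤ L) {x : ℝ} (hx : x ∈ PP L) : x ≤ 1/2 + (1/2)^L ∨ x = 1 := by
  have hp : (0:ℝ) < (1/2)^L := by positivity
  rcases hx with rfl | rfl | ⟨i, hi, w, rfl⟩
  · left; positivity
  · right; rfl
  · left
    have h0 := SS_nonneg (c := (1/2)^L) (by positivity) w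
    have h1 := SS_le_one (c := (1/2)^L) (by positivity) (pow_bound hL) w
    rcases i with _ | i
    · rw [SS_step (by positivity) (pow_bound hL) w]
      have h1 := SS_le_one (c := (1/2)^L) (by positivity) (pow_bound hL) (shft w)
      have := mul_le_mul_of_nonneg_left h1 hp.le
      split_ifs <;> linarith
    · have : ((1:ℝ)/2)^(i+1) * SS ((1/2)^L) w ≤ 1/2 * 1 := by
        refine mul_le_mul ?_ h1 h0 (by norm_num)
        rw [pow_succ]
        have : ((1:ℝ)/2)^i ≤ 1 := pow_le_one₀ (by norm_num) (by norm_num)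
        linarith
      linarith

lemma PP_step {L : ℕ} (hL : 2 ≤ L) {x : ℝ} (hx : x ∈ PP L) :
    (x ≤ 1/2 → 2 * x ∈ PP L) ∧ (1/2 ≤ x → 2 * x - 1 ∈ PP L) := by
  have hp : (0:ℝ) < (1/2)^L := by positivity
  have hhalf : ∀ x : ℝ, x = 1/2 → 2 * x ∈ PP L ∧ 2 * x - 1 ∈ PP L := by
    rintro x rfl
    exact ⟨Or.inr (Or.inl (by norm_num)), Or.inl (by norm_num)⟩
  rcases hx with rfl | rfl | ⟨i, hi, w, rfl⟩
  · exact ⟨fun _ => Or.inl (by norm_num), fun h => by norm_num at h⟩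
  · exact ⟨fun h => by norm_num at h, fun _ => Or.inr (Or.inl (by norm_num))⟩
  · have h0 := SS_nonneg (c := (1/2)^L) (by positivity) w
    have h1 := SS_le_one (c := (1/2)^L) (by positivity) (pow_bound hL) w
    rcases i with _ | i
    · have hst := SS_step (c := (1/2)^L) (by positivity) (pow_bound hL) w
      rw [pow_zero, one_mul]
      have k0 := SS_nonneg (c := (1/2)^L) (by positivity) (shft w)
      have k1 := SS_le_one (c := (1/2)^L) (by positivity) (pow_bound hL) (shft w)
      have k2 := mul_le_mul_of_nonneg_left k1 hp.le
      have k3 := mul_nonneg hp.le k0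
      have hpb := pow_bound hL
      have key : 2 * ((1/2)^L * SS ((1/2)^L) (shft w)) ∈ PP L := by
        refine Or.inr (Or.inr ⟨L - 1, by omega, shft w, ?_⟩)
        obtain ⟨M, rfl⟩ : ∃ M, L = M + 1 := ⟨L - 1, by omega⟩
        rw [Nat.add_sub_cancel]
        generalize SS ((1/2)^(M+1)) (shft w) = z
        rw [pow_succ]
        ring
      by_cases hx : SS ((1/2)^L) w = 1/2
      · exact ⟨fun _ => (hhalf _ hx).1, fun _ => (hhalf _ hx).2⟩
      · constructor
        · intro hle
          have hlt := lt_of_le_of_ne hle hx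
          cases hw : w 0
          · simp only [hw] at hst
            rw [hst]
            simpa using key
          · simp only [hw, if_true] at hst
            linarith
        · intro hle
          have hlt := lt_of_le_of_ne hle (Ne.symm hx)
          cases hw : w 0
          · simp only [hw, Bool.false_eq_true, if_false] at hst
            linarith
          · simp only [hw, if_true] at hst
            rw [hst]
            convert key using 1
            ring
    · have hle : ((1:ℝ)/2)^(i+1) * SS ((1/2)^L) w ≤ 1/2 * 1 := by
        refine mul_le_mul ?_ h1 h0 (by norm_num)
        rw [pow_succ]
        have : ((1:ℝ)/2)^i ≤ 1 := pow_le_one₀ (by norm_num) (by norm_num)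
        linarith
      constructor
      · intro _
        refine Or.inr (Or.inr ⟨i, by omega, w, ?_⟩)
        rw [pow_succ]
        ring
      · intro h
        exact (hhalf _ (by linarith)).2

lemma PP_dbl {L : ℕ} (hL : 2 ≤ L) {x : ℝ} (hx : x ∈ PP L) (n : ℕ) : Dbl^[n] x ∈ PP L := by
  induction n with
  | zero => exact hx
  | succ n ih =>
    rw [Function.iterate_succ_apply']
    have := PP_step hL ih
    generalize Dbl^[n] x = y at *
    unfold Dbl
    split_ifs with h
    · exact this.1 h
    · exact this.2 (by linarith)

lemma PP_dbl' {L : ℕ} (hL : 2 ≤ L) {x : ℝ} (hx : 1 - x ∈ PP L) (n : ℕ) :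
    1 - Dbl^[n] x ∈ PP L := by
  induction n with
  | zero => exact hx
  | succ n ih =>
    rw [Function.iterate_succ_apply']
    have := PP_step hL ih
    generalize Dbl^[n] x = y at *
    unfold Dbl
    split_ifs with h
    · convert this.2 (by linarith) using 1
      ring
    · convert this.1 (by linarith) using 1
      ring

lemma exists_L {c : ℝ} (hc : 1/2 < c) : ∃ L : ℕ, 2 ≤ L ∧ 1/2 + (1/2:ℝ)^L ≤ c := by
  obtain ⟨n, hn⟩ := exists_pow_lt_of_lt_one (sub_pos.2 hc) (by norm_num : (1/2:ℝ) < 1)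
  refine ⟨n + 2, by omega, ?_⟩
  have : (1/2:ℝ)^(n+2) ≤ (1/2)^n :=
    pow_le_pow_of_le_one (by norm_num) (by norm_num) (by omega)
  linarith

theorem stmt1 (a b : ℝ) (ha : 0 < a) (hab : a < b) (hb : b < 1)
    (h : b < 1/2 ∨ 1/2 < a) : 0 < dimH (J a b) := by
  rcases h with h | h
  · obtain ⟨L, hL, hc⟩ := exists_L (c := 1 - b) (by linarith)
    have hsub : (fun x : ℝ => 1 - x) '' Set.range (SS ((1/2)^L)) ⊆ J a b := by
      rintro _ ⟨_, ⟨w, rfl⟩, rfl⟩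
      have hP : 1 - (1 - SS ((1/2)^L) w) ∈ PP L := by
        rw [sub_sub_cancel]; exact PP_range hL w
      refine ⟨?_, fun n hn => ?_⟩
      · have := PP_Icc hL (PP_range hL w)
        constructor <;> simp only <;> linarith
      · rcases PP_bound hL (PP_dbl' hL hP n) with h2 | h2
        · have := hn.2
          simp only at this
          linarith
        · have := hn.1
          simp only at this
          linarith
    have hiso : Isometry (fun x : ℝ => 1 - x) := by
      refine Isometry.of_dist_eq (fun x y => ?_)
      rw [Real.dist_eq, Real.dist_eq, sub_sub_sub_cancel_left, abs_sub_comm]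
    have := dimH_SS_pos hL
    rw [← hiso.dimH_image] at this
    exact this.trans_le (dimH_mono hsub)
  · obtain ⟨L, hL, hc⟩ := exists_L h
    refine (dimH_SS_pos hL).trans_le (dimH_mono ?_)
    rintro _ ⟨w, rfl⟩
    refine ⟨PP_Icc hL (PP_range hL w), fun n hn => ?_⟩
    rcases PP_bound hL (PP_dbl hL (PP_range hL w) n) with h2 | h2
    · linarith [hn.1]
    · linarith [hn.2]

end
end

section
/- Let T be the doubling map and 0 < a < b < 1. If b − a < (1/4)·∏_{n=1}^∞ (1 − 2^{−2ⁿ}) (≈ 0.175092), then dim_H 𝒥(a,b) > 0. -/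
noncomputable section

/-- The digit of a Boolean. -/
def dg (b : Bool) : ℝ := if b then 1 else 0

/-- Value of a binary sequence in base `q`. -/
def val (q : ℝ) (y : ℕ → Bool) : ℝ := ∑' n : ℕ, dg (y n) / q ^ (n+1)

theorem piMap_eq (y : ℕ → Bool) : piMap y = val 2 y := rfl

theorem dg_nonneg (b : Bool) : 0 ≤ dg b := by cases b <;> simp [dg]
theorem dg_le_one (b : Bool) : dg b ≤ 1 := by cases b <;> simp [dg]
theorem dg_not (b : Bool) : dg (!b) = 1 - dg b := by cases b <;> simp [dg]

theorem hasSum_geo {q : ℝ} (hq : 2 ≤ q) : HasSum (fun n : ℕ => 1 / q ^ (n+1)) (1/(q-1)) := by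
  have h0 : 0 < q := by linarith
  have h1 : q⁻¹ < 1 := inv_lt_one_of_one_lt₀ (by linarith)
  have h := (hasSum_geometric_of_lt_one (by positivity) h1).mul_left q⁻¹
  have e : q⁻¹ * (1 - q⁻¹)⁻¹ = 1/(q-1) := by
    have : q - 1 ≠ 0 := by linarith
    field_simp
  rw [e] at h
  refine h.congr_fun ?_ |> fun h => h
  intro n
  simp [pow_succ, mul_comm]

theorem val_summable {q : ℝ} (hq : 2 ≤ q) (y : ℕ → Bool) :
    Summable (fun n : ℕ => dg (y n) / q ^ (n+1)) := by
  have h0 : 0 < q := by linarith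
  refine Summable.of_nonneg_of_le (fun n => ?_) (fun n => ?_) (hasSum_geo hq).summable
  · exact div_nonneg (dg_nonneg _) (by positivity)
  · gcongr
    exact dg_le_one _

theorem val_nonneg {q : ℝ} (hq : 2 ≤ q) (y : ℕ → Bool) : 0 ≤ val q y :=
  tsum_nonneg fun n => div_nonneg (dg_nonneg _) (by positivity)

theorem val_le {q : ℝ} (hq : 2 ≤ q) (y : ℕ → Bool) : val q y ≤ 1/(q-1) := by
  rw [← (hasSum_geo hq).tsum_eq]
  refine Summable.tsum_le_tsum (fun n => ?_) (val_summable hq y) (hasSum_geo hq).summable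
  gcongr
  exact dg_le_one _

theorem val_le_one {q : ℝ} (hq : 2 ≤ q) (y : ℕ → Bool) : val q y ≤ 1 := by
  refine (val_le hq y).trans ?_
  rw [div_le_one (by linarith)]
  linarith

theorem val_step {q : ℝ} (hq : 2 ≤ q) (y : ℕ → Bool) :
    val q y = (dg (y 0) + val q (shft y)) / q := by
  have h0 : 0 < q := by linarith
  unfold val
  rw [(val_summable hq y).tsum_eq_zero_add, add_div, ← tsum_div_const]
  congr 1
  · simp
  · congr 1
    ext n
    simp only [shft]
    field_simp
    ring

theorem shft_iter (n : ℕ) (y : ℕ → Bool) : shft^[n] y = fun i => y (n + i) := by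
  induction n generalizing y with
  | zero => simp
  | succ n ih =>
    rw [Function.iterate_succ_apply, ih]
    ext i
    simp [shft]
    congr 1
    ring

theorem val_iter {q : ℝ} (hq : 2 ≤ q) (L : ℕ) (y : ℕ → Bool) :
    val q y = ∑ i ∈ Finset.range L, dg (y i) / q^(i+1) + val q (shft^[L] y) / q^L := by
  have h0 : 0 < q := by linarith
  induction L with
  | zero => simp
  | succ L ih =>
    rw [Finset.sum_range_succ, Function.iterate_succ_apply', ih, val_step hq (shft^[L] y),
      shft_iter]
    simp only [add_zero]
    field_simp
    ring

theorem val_not {q : ℝ} (hq : 2 ≤ q) (y : ℕ → Bool) :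
    val q (fun n => !y n) = 1/(q-1) - val q y := by
  have h := (hasSum_geo hq).sub (val_summable hq y).hasSum
  rw [val, val, ← h.tsum_eq]
  congr 1
  ext n
  rw [dg_not, sub_div]

/-- Uniqueness of bounded solutions of a contracting functional equation. -/
theorem fun_unique {Q B : ℝ} (hQ : 2 ≤ Q) (G : (ℕ → Bool) → ℝ) (hB : ∀ c, |G c| ≤ B)
    (hG : ∀ c, G c = G (shft c) / Q) (c : ℕ → Bool) : G c = 0 := by
  have h0 : 0 < Q := by linarith
  have key : ∀ n : ℕ, ∀ c, |G c| ≤ B * (Q⁻¹)^n := by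
    intro n
    induction n with
    | zero => intro c; simpa using hB c
    | succ n ih =>
      intro c
      rw [hG c, abs_div, abs_of_pos h0, pow_succ, ← mul_assoc, ← div_eq_mul_inv]
      gcongr
      exact ih _
  have hl : Filter.Tendsto (fun n : ℕ => B * (Q⁻¹)^n) Filter.atTop (nhds (B * 0)) :=
    (tendsto_pow_atTop_nhds_zero_of_lt_one (by positivity)
      (inv_lt_one_of_one_lt₀ (by linarith))).const_mul B
  have := ge_of_tendsto' hl (fun n => key n c)
  simpa using this

/-- First difference. -/
theorem first_diff {c d : ℕ → Bool} (h : c ≠ d) : ∃ n, (∀ i < n, c i = d i) ∧ c n ≠ d n := by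
  classical
  have hex : ∃ n, c n ≠ d n := by
    by_contra! hh
    exact h (funext hh)
  refine ⟨Nat.find hex, fun i hi => ?_, Nat.find_spec hex⟩
  simpa using Nat.find_min hex hi

theorem val_sub {q : ℝ} (hq : 2 ≤ q) {n : ℕ} {c d : ℕ → Bool} (h : ∀ i < n, c i = d i) :
    val q c - val q d = (val q (shft^[n] c) - val q (shft^[n] d)) / q^n := by
  rw [val_iter hq n c, val_iter hq n d]
  have : ∑ i ∈ Finset.range n, dg (c i) / q^(i+1) = ∑ i ∈ Finset.range n, dg (d i) / q^(i+1) :=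
    Finset.sum_congr rfl fun i hi => by rw [h i (Finset.mem_range.mp hi)]
  rw [this]
  ring

theorem abs_val_sub_le {q : ℝ} (hq : 2 ≤ q) {n : ℕ} {c d : ℕ → Bool} (h : ∀ i < n, c i = d i) :
    |val q c - val q d| ≤ 1 / q^n := by
  have h0 : 0 < q := by linarith
  rw [val_sub hq h, abs_div, abs_of_pos (pow_pos h0 n)]
  gcongr
  have := val_nonneg hq (shft^[n] c)
  have := val_nonneg hq (shft^[n] d)
  have := val_le_one hq (shft^[n] c)
  have := val_le_one hq (shft^[n] d)
  rw [abs_le]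
  constructor <;> linarith

theorem le_abs_val_sub {q : ℝ} (hq : 4 ≤ q) {n : ℕ} {c d : ℕ → Bool} (h : ∀ i < n, c i = d i)
    (hn : c n ≠ d n) : 1 / (2 * q) / q^n ≤ |val q c - val q d| := by
  have h0 : 0 < q := by linarith
  have hq2 : 2 ≤ q := by linarith
  rw [val_sub hq2 h, abs_div, abs_of_pos (pow_pos h0 n)]
  gcongr
  rw [val_step hq2 (shft^[n] c), val_step hq2 (shft^[n] d), ← sub_div, abs_div, abs_of_pos h0,
    div_le_div_iff₀ (by positivity) h0]
  have a1 := val_nonneg hq2 (shft (shft^[n] c))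
  have a2 := val_nonneg hq2 (shft (shft^[n] d))
  have hb : 1/(q-1) ≤ 1/2 := by
    apply one_div_le_one_div_of_le <;> linarith
  have a3 := (val_le hq2 (shft (shft^[n] c))).trans hb
  have a4 := (val_le hq2 (shft (shft^[n] d))).trans hb
  have e1 : (shft^[n] c) 0 = c n := by rw [shft_iter]; simp
  have e2 : (shft^[n] d) 0 = d n := by rw [shft_iter]; simp
  rw [e1, e2]
  have : 1/2 ≤ |dg (c n) + val q (shft (shft^[n] c)) - (dg (d n) + val q (shft (shft^[n] d)))| := by
    rw [le_abs]
    cases hc : c n <;> cases hd : d n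
    · simp_all
    · right; simp [dg]; linarith
    · left; simp [dg]; linarith
    · simp_all
  nlinarith

theorem val_surj {x : ℝ} (hx : x ∈ Set.Ico (0:ℝ) 1) : ∃ c, val 2 c = x := by
  refine ⟨fun n => decide (Real.digits x 2 n = 1), ?_⟩
  refine Eq.trans ?_ (Real.ofDigits_digits (b := 2) (by norm_num) hx)
  rw [val, Real.ofDigits]
  congr 1
  ext n
  rw [Real.ofDigitsTerm, div_eq_mul_inv]
  congr 1
  generalize Real.digits x 2 n = d
  fin_cases d <;> simp [dg]

theorem dim_pos (S : Set ℝ) (L : ℕ) (hL : 2 ≤ L) (α β : ℝ) (hβ : β ≠ 0)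
    (hS : ∀ c, α + β * val (2^L) c ∈ S) : 0 < dimH S := by
  have hq : (4:ℝ) ≤ 2^L := by
    calc (4:ℝ) = 2^2 := by norm_num
      _ ≤ 2^L := pow_le_pow_right₀ (by norm_num) hL
  have hq0 : (0:ℝ) < 2^L := by linarith
  set F : (ℕ → Bool) → ℝ := fun c => α + β * val (2^L) c with hF
  let g : ℝ → ℝ := fun y => val 2 (Function.invFun F y)
  have hL0 : (0:ℝ) < L := by positivity
  let r : NNReal := (L:NNReal)⁻¹
  have hrc : (r : ℝ) = (L:ℝ)⁻¹ := by simp [r]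
  let C0 : ℝ := (2 * 2^L / |β|) ^ ((L:ℝ)⁻¹)
  have hβ' : 0 < |β| := abs_pos.mpr hβ
  have hC0 : 0 ≤ C0 := by positivity
  have key : ∀ c d, |val 2 c - val 2 d| ≤ C0 * |F c - F d| ^ ((L:ℝ)⁻¹) := by
    intro c d
    by_cases hcd : c = d
    · subst hcd; simp; positivity
    obtain ⟨n, h1, h2⟩ := first_diff hcd
    refine (abs_val_sub_le (by norm_num) h1).trans ?_
    have h3 := le_abs_val_sub hq h1 h2
    have h4 : |F c - F d| = |β| * |val (2^L) c - val (2^L) d| := by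
      rw [← abs_mul]; congr 1; simp only [hF]; ring
    rw [h4, ← Real.mul_rpow (by positivity) (by positivity)]
    have h5 : (1 / 2^n : ℝ) = ((1/2^n)^L) ^ ((L:ℝ)⁻¹) := by
      rw [Real.pow_rpow_inv_natCast (by positivity) (by omega)]
    rw [h5]
    apply Real.rpow_le_rpow (by positivity) _ (by positivity)
    have h6 : 2 * 2 ^ L / |β| * (|β| * |val (2 ^ L) c - val (2 ^ L) d|) =
      (2 * 2^L) * |val (2 ^ L) c - val (2 ^ L) d| := by field_simp
    rw [h6]
    calc ((1:ℝ)/2^n)^L = (2*2^L) * (1 / (2 * 2^L) / (2^L)^n) := by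
          rw [div_pow, one_pow, ← pow_mul, ← pow_mul, mul_comm n L]; field_simp
      _ ≤ _ := by gcongr
  have hinj : ∀ c, F (Function.invFun F (F c)) = F c := fun c => Function.invFun_eq ⟨c, rfl⟩
  have hh : HolderOnWith C0.toNNReal r g (Set.range F) := by
    rintro _ ⟨c, rfl⟩ _ ⟨d, rfl⟩
    have := key (Function.invFun F (F c)) (Function.invFun F (F d))
    rw [hinj, hinj] at this
    rw [edist_dist, edist_dist, Real.dist_eq, Real.dist_eq]
    rw [ENNReal.ofReal_rpow_of_nonneg (abs_nonneg _) (by positivity)]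
    rw [hrc]
    change _ ≤ ENNReal.ofReal C0 * _
    rw [← ENNReal.ofReal_mul hC0]
    exact ENNReal.ofReal_le_ofReal this
  have hr : 0 < r := by
    rw [← NNReal.coe_pos, hrc]; positivity
  have hle := hh.dimH_image_le hr
  have hFinj : Function.Injective F := by
    intro c d hcd
    by_contra hne
    obtain ⟨n, h1, h2⟩ := first_diff hne
    have h3 := le_abs_val_sub hq h1 h2
    have h4 : val (2^L) c = val (2^L) d := by
      have : β * val (2^L) c = β * val (2^L) d := by simp only [hF] at hcd; linarith
      exact mul_left_cancel₀ hβ this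
    rw [h4, sub_self, abs_zero] at h3
    have : 0 < 1 / (2 * (2:ℝ)^L) / (2^L)^n := by positivity
    linarith
  have hsub : Set.Ico (0:ℝ) 1 ⊆ g '' Set.range F := by
    intro x hx
    obtain ⟨c, rfl⟩ := val_surj hx
    refine ⟨F c, ⟨c, rfl⟩, ?_⟩
    simp only [g]
    rw [Function.leftInverse_invFun hFinj c]
  have h1 : dimH (Set.Ico (0:ℝ) 1) = 1 := by
    rw [Real.dimH_of_nonempty_interior (by simp)]
    simp
  have h2 : (1:ENNReal) ≤ dimH (Set.range F) / r := by
    rw [← h1]; exact (dimH_mono hsub).trans hle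
  have h3 : dimH (Set.range F) ≠ 0 := by
    intro h0
    rw [h0] at h2
    simp at h2
  have h4 : dimH (Set.range F) ≤ dimH S := dimH_mono (by rintro _ ⟨c, rfl⟩; exact hS c)
  exact (pos_iff_ne_zero.mpr h3).trans_le h4

/-- A Cantor family of sequences avoiding the hole. -/
def Avoid (a b : ℝ) : Prop := ∃ L : ℕ, 2 ≤ L ∧ ∃ α β : ℝ, β ≠ 0 ∧ ∀ c : ℕ → Bool, ∃ x : ℕ → Bool,
  val 2 x = α + β * val (2^L) c ∧
  ∀ n, val 2 (shft^[n] x) ≠ 1/2 ∧ val 2 (shft^[n] x) ∉ Set.Ioo a b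

theorem Dbl_val (w : ℕ → Bool) (h : val 2 w ≠ 1/2) : Dbl (val 2 w) = val 2 (shft w) := by
  have h1 := val_step (le_refl (2:ℝ)) w
  have h2 := val_nonneg (le_refl (2:ℝ)) (shft w)
  have h3 := val_le_one (le_refl (2:ℝ)) (shft w)
  unfold Dbl
  cases hw : w 0
  · simp [hw, dg] at h1
    rw [if_pos (by linarith)]
    linarith
  · simp [hw, dg] at h1
    have : val 2 w ≥ 1/2 := by linarith
    rw [if_neg (by rw [not_le]; exact lt_of_le_of_ne this (Ne.symm h))]
    linarith

theorem Dbl_iter (x : ℕ → Bool) (h : ∀ n, val 2 (shft^[n] x) ≠ 1/2) (n : ℕ) :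
    Dbl^[n] (val 2 x) = val 2 (shft^[n] x) := by
  induction n with
  | zero => rfl
  | succ n ih =>
    rw [Function.iterate_succ_apply', Function.iterate_succ_apply', ih, Dbl_val _ (h n)]

theorem Avoid.dim {a b : ℝ} (h : Avoid a b) : 0 < dimH (J a b) := by
  obtain ⟨L, hL, α, β, hβ, H⟩ := h
  refine dim_pos _ L hL α β hβ fun c => ?_
  obtain ⟨x, hx, hn⟩ := H c
  rw [← hx]
  refine ⟨⟨val_nonneg le_rfl _, val_le_one le_rfl _⟩, fun n => ?_⟩
  rw [Dbl_iter x (fun n => (hn n).1)]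
  exact (hn n).2

theorem Avoid.flip {a b : ℝ} (h : Avoid a b) : Avoid (1-b) (1-a) := by
  obtain ⟨L, hL, α, β, hβ, H⟩ := h
  refine ⟨L, hL, 1-α, -β, by simpa using hβ, fun c => ?_⟩
  obtain ⟨x, hx, hn⟩ := H c
  refine ⟨fun n => !x n, ?_, fun n => ?_⟩
  · rw [val_not le_rfl, hx]; norm_num; ring
  · have e : shft^[n] (fun n => !x n) = fun i => !(shft^[n] x) i := by
      rw [shft_iter, shft_iter]
    rw [e, val_not le_rfl]
    obtain ⟨h1, h2⟩ := hn n
    constructor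
    · intro h3; apply h1; norm_num at h3; linarith
    · intro h3; apply h2; norm_num at h3; constructor <;> linarith [h3.1, h3.2]

theorem Avoid.flip' {a b : ℝ} (h : Avoid (1-b) (1-a)) : Avoid a b := by
  simpa using h.flip

/-! Lexicographic order -/

theorem seqLe_of {u v : ℕ → Bool}
    (h : ∀ n, (∀ i < n, u i = v i) → u n = true → v n = false → False) : seqLe u v := by
  by_cases huv : u = v
  · exact Or.inr huv
  obtain ⟨n, h1, h2⟩ := first_diff huv
  left
  refine ⟨n, h1, ?_⟩
  have := h n h1
  cases hu : u n <;> cases hv : v n <;> simp_all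

theorem val_mono {u v : ℕ → Bool} (h : seqLe u v) : val 2 u ≤ val 2 v := by
  rcases h with ⟨n, h1, h2⟩ | rfl
  · rw [← sub_nonneg, val_sub le_rfl (fun i hi => (h1 i hi).symm)]
    apply div_nonneg _ (by positivity)
    rw [val_step le_rfl (shft^[n] u), val_step le_rfl (shft^[n] v)]
    have e1 : (shft^[n] u) 0 = u n := by rw [shft_iter]; simp
    have e2 : (shft^[n] v) 0 = v n := by rw [shft_iter]; simp
    rw [e1, e2]
    have h3 := val_nonneg le_rfl (shft (shft^[n] v))
    have h4 := val_le_one le_rfl (shft (shft^[n] u))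
    cases hu : u n <;> cases hv : v n <;> rw [hu, hv] at h2
    · simp at h2
    · simp [dg]; linarith
    · exact absurd h2 (by decide)
    · simp at h2
  · exact le_rfl

/-- All shifts of `x` avoid the symbolic hole `(α,β)`. -/
def Good (α β x : ℕ → Bool) : Prop := ∀ n, (x n = false → seqLe (fun i => x (n+i)) α) ∧
  (x n = true → seqLe β (fun i => x (n+i)))

/-- Thue–Morse substitution. -/
def tau (y : ℕ → Bool) : ℕ → Bool := fun n => if n % 2 = 0 then y (n/2) else !y (n/2)

theorem tau_even (y : ℕ → Bool) (n : ℕ) : tau y (2*n) = y n := by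
  simp [tau]
theorem tau_odd (y : ℕ → Bool) (n : ℕ) : tau y (2*n+1) = !y n := by
  have : (2*n+1)/2 = n := by omega
  simp [tau, this, Nat.add_mod]

theorem tau_mono {u v : ℕ → Bool} (h : seqLe u v) : seqLe (tau u) (tau v) := by
  rcases h with ⟨n, h1, h2⟩ | rfl
  · left
    refine ⟨2*n, fun i hi => ?_, ?_⟩
    · simp only [tau, h1 (i/2) (by omega)]
    · rwa [tau_even, tau_even]
  · exact Or.inr rfl

theorem seqLe_of_two {u v : ℕ → Bool} (h0 : u 0 = v 0) (h1 : u 1 = false) (h2 : v 1 = true) :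
    seqLe u v := by
  left
  refine ⟨1, fun i hi => ?_, by simp [h1, h2]⟩
  obtain rfl : i = 0 := by omega
  exact h0

theorem seqLe_of_three {u v : ℕ → Bool} (h0 : u 0 = v 0) (h0' : u 1 = v 1) (h1 : u 2 = false)
    (h2 : v 2 = true) : seqLe u v := by
  left
  refine ⟨2, fun i hi => ?_, by simp [h1, h2]⟩
  obtain rfl | rfl : i = 0 ∨ i = 1 := by omega
  · exact h0
  · exact h0'

theorem Good.tau {α β x : ℕ → Bool} (h : Good α β x) (ha0 : α 0 = false) (ha1 : α 1 = true)
    (hb0 : β 0 = true) (hb1 : β 1 = false) : Good (tau α) (tau β) (tau x) := by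
  have A0 : _root_.tau α 0 = false := by simp [_root_.tau, ha0]
  have A1 : _root_.tau α 1 = true := by simp [_root_.tau, ha0]
  have A2 : _root_.tau α 2 = true := by simp [_root_.tau, ha1]
  have B0 : _root_.tau β 0 = true := by simp [_root_.tau, hb0]
  have B1 : _root_.tau β 1 = false := by simp [_root_.tau, hb0]
  have B2 : _root_.tau β 2 = false := by simp [_root_.tau, hb1]
  intro n
  rcases Nat.even_or_odd' n with ⟨k, rfl | rfl⟩
  · have e : (fun i => _root_.tau x (2*k+i)) = _root_.tau (fun i => x (k+i)) := by
      ext i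
      have e1 : (2*k+i) % 2 = i % 2 := by omega
      have e2 : (2*k+i)/2 = k + i/2 := by omega
      simp only [_root_.tau, e1, e2]
    rw [e, tau_even]
    exact ⟨fun hx => tau_mono ((h k).1 hx), fun hx => tau_mono ((h k).2 hx)⟩
  · have e1 : _root_.tau x (2*k+1+1) = x (k+1) := tau_even x (k+1)
    have e2 : _root_.tau x (2*k+1+2) = !x (k+1) := tau_odd x (k+1)
    constructor
    · intro hx
      cases hk : x (k+1)
      · exact seqLe_of_two (by simp [hx, A0]) (by simp [e1, hk]) A1
      · exact seqLe_of_three (by simp [hx, A0]) (by simp [e1, hk, A1]) (by simp [e2, hk]) A2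
    · intro hx
      cases hk : x (k+1)
      · exact seqLe_of_three (by simp [hx, B0]) (by simp [e1, hk, B1]) B2 (by simp [e2, hk])
      · exact seqLe_of_two (by simp [hx, B0]) B1 (by simp [e1, hk])

theorem tau_iter_start {α : ℕ → Bool} (j : ℕ) {b : Bool} (h0 : α 0 = b) (h1 : α 1 = !b) :
    (tau^[j] α) 0 = b ∧ (tau^[j] α) 1 = !b := by
  induction j with
  | zero => exact ⟨h0, h1⟩
  | succ j ih =>
    rw [Function.iterate_succ_apply']
    constructor
    · simp [tau, ih.1]
    · simp [tau, ih.1]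

theorem Good.tau_iter {α β x : ℕ → Bool} (h : Good α β x) (ha0 : α 0 = false) (ha1 : α 1 = true)
    (hb0 : β 0 = true) (hb1 : β 1 = false) (j : ℕ) :
    Good (_root_.tau^[j] α) (_root_.tau^[j] β) (_root_.tau^[j] x) := by
  induction j with
  | zero => exact h
  | succ j ih =>
    rw [Function.iterate_succ_apply', Function.iterate_succ_apply', Function.iterate_succ_apply']
    have ⟨a0, a1⟩ := tau_iter_start j ha0 ha1
    have ⟨b0, b1⟩ := tau_iter_start j hb0 hb1
    exact ih.tau a0 a1 b0 b1

theorem val_tau {q : ℝ} (hq : 2 ≤ q) (y : ℕ → Bool) :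
    val q (tau y) = 1/(q^2-1) + (q-1) * val (q^2) y := by
  have hq2 : 2 ≤ q^2 := by nlinarith
  have hq0 : 0 < q := by linarith
  have hne : q^2-1 ≠ 0 := by nlinarith
  suffices val q (tau y) - (1/(q^2-1) + (q-1) * val (q^2) y) = 0 by linarith
  refine fun_unique (B := 1 + 1/(q^2-1) + (q-1)) hq2
    (fun y => val q (tau y) - (1/(q^2-1) + (q-1) * val (q^2) y)) (fun c => ?_) (fun c => ?_) y
  · have h1 := val_nonneg hq (tau c)
    have h2 := val_le_one hq (tau c)
    have h3 := val_nonneg hq2 c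
    have h4 := val_le_one hq2 c
    have h5 : 0 < 1/(q^2-1) := by apply div_pos one_pos; nlinarith
    rw [abs_le]
    constructor <;> nlinarith
  · have e : shft (shft (tau c)) = tau (shft c) := by
      ext i
      have e1 : (i+1+1) % 2 = i % 2 := by omega
      have e2 : (i+1+1)/2 = i/2+1 := by omega
      simp only [shft, tau, e1, e2]
    rw [val_step hq (tau c), val_step hq (shft (tau c)), e, val_step hq2 c]
    have e0 : tau c 0 = c 0 := tau_even c 0
    have e1 : shft (tau c) 0 = !c 0 := tau_odd c 0
    rw [e0, e1, dg_not]
    field_simp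
    ring

/-- `m_j = 2^(2^j)`. -/
def mm (j : ℕ) : ℝ := 2^(2^j)
/-- `D_j = ∏_{i<j} (m_i - 1)`. -/
def DD : ℕ → ℝ
  | 0 => 1
  | j+1 => DD j * (mm j - 1)

theorem mm_succ (j : ℕ) : mm (j+1) = mm j ^ 2 := by
  simp [mm, pow_succ, pow_mul]

theorem two_le_mm (j : ℕ) : 2 ≤ mm j := by
  unfold mm
  calc (2:ℝ) = 2^1 := by norm_num
    _ ≤ 2^(2^j) := pow_le_pow_right₀ (by norm_num) Nat.one_le_two_pow

theorem DD_pos (j : ℕ) : 0 < DD j := by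
  induction j with
  | zero => simp [DD]
  | succ j ih =>
    have := two_le_mm j
    simp only [DD]
    apply mul_pos ih; linarith

theorem val_tau_iter (j : ℕ) (y : ℕ → Bool) :
    val 2 (tau^[j] y) = 1/2 - DD j / (2*(mm j - 1)) + DD j * val (mm j) y := by
  induction j generalizing y with
  | zero => norm_num [DD, mm]
  | succ j ih =>
    have h := two_le_mm j
    have h1 : mm j - 1 ≠ 0 := by linarith
    have h2 : mm j + 1 ≠ 0 := by linarith
    have h3 : mm j ^ 2 - 1 ≠ 0 := by nlinarith
    rw [Function.iterate_succ_apply, ih, val_tau h, mm_succ, DD]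
    have h4 : mm j ^ 2 - 1 = (mm j - 1) * (mm j + 1) := by ring
    rw [h4]
    field_simp
    ring

/-- Block coding. -/
def blk (W : Bool → ℕ → Bool) (L : ℕ) (c : ℕ → Bool) : ℕ → Bool := fun n => W (c (n/L)) (n%L)

theorem blk_at (W : Bool → ℕ → Bool) {L : ℕ} (hL : 0 < L) (c : ℕ → Bool) (k i : ℕ)
    (hi : i < 2*L) :
    blk W L c (L*k+i) = if i < L then W (c k) i else W (c (k+1)) (i-L) := by
  unfold blk
  split_ifs with h
  · rw [Nat.mul_add_div hL, Nat.div_eq_of_lt h, Nat.mul_add_mod, Nat.mod_eq_of_lt h, add_zero]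
  · obtain ⟨r, rfl⟩ : ∃ r, i = L + r := ⟨i - L, by omega⟩
    have hr : r < L := by omega
    rw [show L*k+(L+r) = L*(k+1)+r by ring, Nat.mul_add_div hL, Nat.div_eq_of_lt hr,
      Nat.mul_add_mod, Nat.mod_eq_of_lt hr, add_zero, Nat.add_sub_cancel_left]

theorem blk_shft (W : Bool → ℕ → Bool) {L : ℕ} (hL : 0 < L) (c : ℕ → Bool) :
    shft^[L] (blk W L c) = blk W L (shft c) := by
  rw [shft_iter]
  ext i
  simp only [blk, shft]
  rw [Nat.add_div_left _ hL, Nat.add_mod_left]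

theorem val_blk {q : ℝ} (hq : 2 ≤ q) (W : Bool → ℕ → Bool) {L : ℕ} (hL : 0 < L) (c : ℕ → Bool)
    (P : Bool → ℝ) (hP : ∀ b, P b = ∑ i ∈ Finset.range L, dg (W b i) / q^(i+1)) :
    val q (blk W L c) = P false * q^L/(q^L-1) + q^L * (P true - P false) * val (q^L) c := by
  have hQ : 2 ≤ q^L := by
    calc 2 ≤ q := hq
      _ = q^1 := (pow_one q).symm
      _ ≤ q^L := pow_le_pow_right₀ (by linarith) hL
  suffices val q (blk W L c) -
    (P false * q^L/(q^L-1) + q^L * (P true - P false) * val (q^L) c) = 0 by linarith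
  refine fun_unique (B := 1 + |P false * q^L/(q^L-1)| + |q^L * (P true - P false)|) hQ
    (fun c => val q (blk W L c) -
    (P false * q^L/(q^L-1) + q^L * (P true - P false) * val (q^L) c)) (fun c => ?_) (fun c => ?_) c
  · have h1 := val_nonneg hq (blk W L c)
    have h2 := val_le_one hq (blk W L c)
    have h3 := val_nonneg hQ c
    have h4 := val_le_one hQ c
    refine (abs_sub _ _).trans ?_
    refine (add_le_add le_rfl (abs_add_le _ _)).trans ?_
    rw [abs_mul _ (val (q^L) c), abs_of_nonneg h1, abs_of_nonneg h3, ← add_assoc]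
    gcongr
    exact mul_le_of_le_one_right (abs_nonneg _) h4
  · have hs : ∑ i ∈ Finset.range L, dg (blk W L c i) / q^(i+1) = P (c 0) := by
      rw [hP]
      refine Finset.sum_congr rfl fun i hi => ?_
      have hi := Finset.mem_range.mp hi
      simp only [blk]
      rw [Nat.div_eq_of_lt hi, Nat.mod_eq_of_lt hi]
    rw [val_iter hq L (blk W L c), blk_shft W hL, val_step hQ c, hs]
    have hne : q^L - 1 ≠ 0 := by linarith
    have hne' : q ≠ 0 := by linarith
    cases c 0 <;> simp [dg] <;> field_simp <;> ring

theorem Good.avoid {α β x : ℕ → Bool} (h : Good α β x) {a b : ℝ} (h1 : val 2 α ≤ a)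
    (h2 : b ≤ val 2 β) (h3 : val 2 α < 1/2) (h4 : 1/2 < val 2 β) (n : ℕ) :
    val 2 (shft^[n] x) ≠ 1/2 ∧ val 2 (shft^[n] x) ∉ Set.Ioo a b := by
  rw [shft_iter]
  cases hx : x n
  · have := val_mono ((h n).1 hx)
    exact ⟨by linarith, fun h => by linarith [h.1]⟩
  · have := val_mono ((h n).2 hx)
    exact ⟨fun h => by linarith, fun h => by linarith [h.2]⟩

theorem val_pos {y : ℕ → Bool} {k : ℕ} (h : y k = true) : 0 < val 2 y := by
  rw [val_iter le_rfl (k+1), Finset.sum_range_succ, h]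
  have h1 : 0 ≤ ∑ i ∈ Finset.range k, dg (y i) / (2:ℝ)^(i+1) :=
    Finset.sum_nonneg fun i _ => div_nonneg (dg_nonneg _) (by positivity)
  have h2 := val_nonneg le_rfl (shft^[k+1] y)
  have h3 : 0 < dg true / (2:ℝ)^(k+1) := by simp [dg]
  have h4 : 0 ≤ val 2 (shft^[k+1] y) / 2^(k+1) := by positivity
  linarith

theorem val_ne_half {y : ℕ → Bool} {k l : ℕ} (h : y (k+1) = true) (h' : y (l+1) = false) :
    val 2 y ≠ 1/2 := by
  rw [val_step le_rfl]
  have h1 : 0 < val 2 (shft y) := val_pos (k := k) h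
  have h2 : 0 < val 2 (fun n => !(shft y) n) := val_pos (k := l) (by simp [shft, h'])
  rw [val_not le_rfl] at h2
  norm_num at h2
  cases y 0 <;> simp [dg] <;> intro h3 <;> linarith

theorem val_lower {y : ℕ → Bool} {N : ℕ} (h : ∀ i, i < N → y (i+1) = true) :
    1/2 - 1/2^N ≤ val 2 y := by
  have h1 : |val 2 (shft y) - val 2 (fun _ => true)| ≤ 1/2^N :=
    abs_val_sub_le le_rfl (fun i hi => h i hi)
  have h2 : val 2 (fun _ => true) = 1 := by
    have := val_not (le_refl (2:ℝ)) (fun _ => false)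
    have h0 : val 2 (fun _ => false) = 0 := by simp [val, dg]
    rw [h0] at this
    norm_num at this
    exact this
  rw [h2, abs_le] at h1
  rw [val_step le_rfl]
  have := dg_nonneg (y 0)
  have h3 : (0:ℝ) < 1/2^N := by positivity
  linarith [h1.1]

/-- Words for holes below `1/2`. -/
def WA (L : ℕ) (b : Bool) (i : ℕ) : Bool := if i = 0 then b else decide (i ≠ L)

theorem avoid_A {a b : ℝ} (hb : b < 1/2) : Avoid a b := by
  obtain ⟨N, hN⟩ := exists_pow_lt_of_lt_one (show (0:ℝ) < 1/2 - b by linarith)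
    (show (1/2:ℝ) < 1 by norm_num)
  set L := N + 2 with hL
  refine ⟨2*L, by omega, _, _, ?_, fun c => ⟨blk (WA L) (2*L) c,
    val_blk le_rfl (WA L) (by omega) c
      (fun b => ∑ i ∈ Finset.range (2*L), dg (WA L b i) / 2^(i+1)) (fun b => rfl), fun n => ?_⟩⟩
  · apply mul_ne_zero (by positivity)
    rw [show 2*L = (2*N+3)+1 by omega]
    simp only [Finset.sum_range_succ' _ (2*N+3)]
    simp [WA, dg]
  · rw [shft_iter]
    set x := blk (WA L) (2*L) c with hx
    have hat := blk_at (WA L) (show 0 < 2*L by omega) c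
    constructor
    · have e1 := hat (n+1) 1 (by omega)
      have e2 := hat (n+1) L (by omega)
      have f1 : WA L (c (n+1)) 1 = true := by simp [WA, hL]
      have f2 : WA L (c (n+1)) L = false := by simp [WA, hL]
      rw [if_pos (by omega), f1] at e1
      rw [if_pos (by omega), f2] at e2
      have g : n ≤ 2*L*(n+1) := by nlinarith
      refine val_ne_half (k := 2*L*(n+1) - n) (l := 2*L*(n+1)+L-n-1) ?_ ?_
      · rw [← e1]; congr 1; omega
      · rw [← e2]; congr 1; omega
    · intro hmem
      cases hxn : x n
      · have : 1/2 - 1/2^N ≤ val 2 (fun i => x (n+i)) := by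
          apply val_lower
          intro i hi
          obtain ⟨k, r, hr, rfl⟩ : ∃ k r, r < 2*L ∧ n = 2*L*k+r :=
            ⟨n/(2*L), n%(2*L), Nat.mod_lt _ (by omega), (Nat.div_add_mod _ _).symm⟩
          have h1 := hat k r (by omega)
          rw [← hx, hxn, if_pos hr] at h1
          have h2 : r = 0 ∨ r = L := by
            by_contra! hh
            simp [WA, hh.1, hh.2] at h1
          rw [add_assoc, hx, hat k (r+(i+1)) (by omega)]
          rcases h2 with rfl | rfl
          · rw [if_pos (by omega)]
            simp [WA]; omega
          · rw [if_pos (by omega)]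
            simp [WA]
        have h3 : (1:ℝ)/2^N = (1/2)^N := by simp
        rw [h3] at this
        linarith [hmem.2]
      · have h1 := val_step (le_refl (2:ℝ)) (fun i => x (n+i))
        have h2 := val_nonneg (le_refl (2:ℝ)) (shft (fun i => x (n+i)))
        simp [hxn, dg] at h1
        linarith [hmem.2]

/-- Words of length 7. -/
def WB (b : Bool) (i : ℕ) : Bool :=
  if b then decide (i = 2 ∨ i = 6) else decide (i = 3 ∨ i = 6)

/-- Words of length 12. -/
def WC (b : Bool) (i : ℕ) : Bool :=
  if b then decide (i = 1 ∨ i = 3 ∨ i = 6 ∨ i = 8 ∨ i = 11)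
  else decide (i = 1 ∨ i = 4 ∨ i = 6 ∨ i = 8 ∨ i = 11)

theorem WB_pat : ∀ b b' : Bool, ∀ r : Fin 7,
    let f : ℕ → Bool := fun i => if i < 7 then WB b i else WB b' (i-7)
    (f r && f (r+1)) = false ∧ (f r && !f (r+1) && f (r+2)) = false ∧
    (!f r && !f (r+1) && !f (r+2) && !f (r+3)) = false := by decide

theorem WC_pat : ∀ b b' : Bool, ∀ r : Fin 12,
    let f : ℕ → Bool := fun i => if i < 12 then WC b i else WC b' (i-12)
    (f r && f (r+1)) = false ∧ (!f r && !f (r+1) && !f (r+2)) = false ∧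
    (!f r && !f (r+1) && f (r+2) && !f (r+3) && !f (r+4)) = false := by decide

theorem blkB_pat (c : ℕ → Bool) (n : ℕ) (f : ℕ → Bool) (hf : f = blk WB 7 c) :
    (f n && f (n+1)) = false ∧ (f n && !f (n+1) && f (n+2)) = false ∧
    (!f n && !f (n+1) && !f (n+2) && !f (n+3)) = false := by
  subst hf
  obtain ⟨k, r, hr, rfl⟩ : ∃ k r, r < 7 ∧ n = 7*k+r :=
    ⟨n/7, n%7, Nat.mod_lt _ (by omega), (Nat.div_add_mod _ _).symm⟩
  have h := WB_pat (c k) (c (k+1)) ⟨r, hr⟩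
  simp only [add_assoc]
  rw [blk_at WB (by omega) c k r (by omega), blk_at WB (by omega) c k (r+1) (by omega),
    blk_at WB (by omega) c k (r+2) (by omega), blk_at WB (by omega) c k (r+3) (by omega)]
  exact h

theorem blkC_pat (c : ℕ → Bool) (n : ℕ) (f : ℕ → Bool) (hf : f = blk WC 12 c) :
    (f n && f (n+1)) = false ∧ (!f n && !f (n+1) && !f (n+2)) = false ∧
    (!f n && !f (n+1) && f (n+2) && !f (n+3) && !f (n+4)) = false := by
  subst hf
  obtain ⟨k, r, hr, rfl⟩ : ∃ k r, r < 12 ∧ n = 12*k+r :=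
    ⟨n/12, n%12, Nat.mod_lt _ (by omega), (Nat.div_add_mod _ _).symm⟩
  have h := WC_pat (c k) (c (k+1)) ⟨r, hr⟩
  simp only [add_assoc]
  rw [blk_at WC (by omega) c k r (by omega), blk_at WC (by omega) c k (r+1) (by omega),
    blk_at WC (by omega) c k (r+2) (by omega), blk_at WC (by omega) c k (r+3) (by omega),
    blk_at WC (by omega) c k (r+4) (by omega)]
  exact h

/-- `(010)^∞` -/
def aB (n : ℕ) : Bool := decide (n % 3 = 1)
/-- `(1000)^∞` -/
def bB (n : ℕ) : Bool := decide (n % 4 = 0)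
/-- `(01)^∞` -/
def aC (n : ℕ) : Bool := decide (n % 2 = 1)
/-- `(10010)^∞` -/
def bC (n : ℕ) : Bool := decide (n % 5 = 0 ∨ n % 5 = 3)

theorem good_B (c : ℕ → Bool) : Good aB bB (blk WB 7 c) := by
  intro n
  have hp := fun m => blkB_pat c m _ rfl
  generalize blk WB 7 c = f at hp
  constructor
  · intro hn
    refine seqLe_of fun i hi h1 h2 => ?_
    have h3 : i % 3 ≠ 1 := by simpa [aB] using h2
    rcases (by omega : i = 0 ∨ i % 3 = 2 ∨ (i % 3 = 0 ∧ 3 ≤ i)) with rfl | h4 | ⟨h4, h5⟩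
    · simp_all
    · obtain ⟨k, rfl⟩ : ∃ k, i = k + 1 := ⟨i-1, by omega⟩
      have h5 := hi k (by omega)
      have h6 : aB k = true := by simp [aB]; omega
      have := (hp (n+k)).1
      simp_all [add_assoc]
    · obtain ⟨k, rfl⟩ : ∃ k, i = k + 2 := ⟨i-2, by omega⟩
      have h5 := hi k (by omega)
      have h6 : aB k = true := by simp [aB]; omega
      have h7 := hi (k+1) (by omega)
      have h8 : aB (k+1) = false := by simp [aB]; omega
      have := (hp (n+k)).2.1
      simp_all [add_assoc]
  · intro hn
    refine seqLe_of fun i hi h1 h2 => ?_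
    have h3 : i % 4 = 0 := by simpa [bB] using h1
    rcases (by omega : i = 0 ∨ 4 ≤ i) with rfl | h4
    · simp_all
    · obtain ⟨k, rfl⟩ : ∃ k, i = k + 3 := ⟨i-3, by omega⟩
      have h5 := hi k (by omega)
      have h6 := hi (k+1) (by omega)
      have h7 := hi (k+2) (by omega)
      have h8 : bB k = false := by simp [bB]; omega
      have h9 : bB (k+1) = false := by simp [bB]; omega
      have h10 : bB (k+2) = false := by simp [bB]; omega
      have := (hp (n+k)).2.2
      simp_all [add_assoc]

theorem good_C (c : ℕ → Bool) : Good aC bC (blk WC 12 c) := by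
  intro n
  have hp := fun m => blkC_pat c m _ rfl
  generalize blk WC 12 c = f at hp
  constructor
  · intro hn
    refine seqLe_of fun i hi h1 h2 => ?_
    have h3 : i % 2 ≠ 1 := by simpa [aC] using h2
    rcases (by omega : i = 0 ∨ 2 ≤ i) with rfl | h4
    · simp_all
    · obtain ⟨k, rfl⟩ : ∃ k, i = k + 1 := ⟨i-1, by omega⟩
      have h5 := hi k (by omega)
      have h6 : aC k = true := by simp [aC]; omega
      have := (hp (n+k)).1
      simp_all [add_assoc]
  · intro hn
    refine seqLe_of fun i hi h1 h2 => ?_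
    have h3 : i % 5 = 0 ∨ i % 5 = 3 := by simpa [bC] using h1
    rcases (by omega : i = 0 ∨ (5 ≤ i ∧ i % 5 = 0) ∨ i % 5 = 3) with rfl | ⟨h4, h5⟩ | h4
    · simp_all
    · obtain ⟨k, rfl⟩ : ∃ k, i = k + 4 := ⟨i-4, by omega⟩
      have h5 := hi k (by omega)
      have h6 := hi (k+1) (by omega)
      have h7 := hi (k+2) (by omega)
      have h7' := hi (k+3) (by omega)
      have h8 : bC k = false := by simp [bC]; omega
      have h9 : bC (k+1) = false := by simp [bC]; omega
      have h10 : bC (k+2) = true := by simp [bC]; omega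
      have h11 : bC (k+3) = false := by simp [bC]; omega
      have := (hp (n+k)).2.2
      simp_all [add_assoc]
    · obtain ⟨k, rfl⟩ : ∃ k, i = k + 2 := ⟨i-2, by omega⟩
      have h5 := hi k (by omega)
      have h6 := hi (k+1) (by omega)
      have h8 : bC k = false := by simp [bC]; omega
      have h9 : bC (k+1) = false := by simp [bC]; omega
      have := (hp (n+k)).2.1
      simp_all [add_assoc]

theorem val_aB : val 2 aB = 2/7 := by
  have h := val_iter (le_refl (2:ℝ)) 3 aB
  have e : shft^[3] aB = aB := by
    rw [shft_iter]; ext i; simp [aB]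
  rw [e] at h
  norm_num [Finset.sum_range_succ, aB, dg] at h
  linarith

theorem val_bB : val 2 bB = 8/15 := by
  have h := val_iter (le_refl (2:ℝ)) 4 bB
  have e : shft^[4] bB = bB := by
    rw [shft_iter]; ext i; simp [bB]
  rw [e] at h
  norm_num [Finset.sum_range_succ, bB, dg] at h
  linarith

theorem val_aC {q : ℝ} (hq : 2 ≤ q) : val q aC = 1/(q^2-1) := by
  have h := val_iter hq 2 aC
  have e : shft^[2] aC = aC := by
    rw [shft_iter]; ext i; simp [aC]
  rw [e] at h
  norm_num [Finset.sum_range_succ, aC, dg] at h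
  have h1 : q^2-1 ≠ 0 := by nlinarith
  have h2 : q ≠ 0 := by linarith
  field_simp at h ⊢
  linarith

theorem val_bC {q : ℝ} (hq : 2 ≤ q) : val q bC = (q^4+q)/(q^5-1) := by
  have h := val_iter hq 5 bC
  have e : shft^[5] bC = bC := by
    rw [shft_iter]; ext i; simp [bC]
  rw [e] at h
  norm_num [Finset.sum_range_succ, bC, dg] at h
  have h1 : q^5-1 ≠ 0 := by
    have : 1 < q^5 := one_lt_pow₀ (by linarith) (by norm_num)
    linarith
  have h2 : q ≠ 0 := by linarith
  field_simp at h ⊢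
  linarith

theorem avoid_B {a b : ℝ} (ha : 2/7 ≤ a) (hb : b ≤ 8/15) : Avoid a b := by
  refine ⟨7, by omega, _, _, ?_, fun c => ⟨blk WB 7 c,
    val_blk le_rfl WB (by omega) c
      (fun b => ∑ i ∈ Finset.range 7, dg (WB b i) / 2^(i+1)) (fun b => rfl), fun n => ?_⟩⟩
  · norm_num [Finset.sum_range_succ, WB, dg]
  · refine (good_B c).avoid ?_ ?_ ?_ ?_ n
    · rwa [val_aB]
    · rwa [val_bB]
    · rw [val_aB]; norm_num
    · rw [val_bB]; norm_num

/-- Corner coordinates. -/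
def AA (j : ℕ) : ℝ := 1/2 - DD j / (2*(mm j + 1))
/-- Corner coordinates. -/
def BB (j : ℕ) : ℝ := 1/2 - DD j / (2*(mm j - 1)) + DD j * ((mm j^4+mm j)/(mm j^5-1))

theorem val_tau_aC (j : ℕ) : val 2 (tau^[j] aC) = AA j := by
  rw [val_tau_iter, val_aC (two_le_mm j), AA]
  have h := two_le_mm j
  have h1 : mm j - 1 ≠ 0 := by linarith
  have h2 : mm j + 1 ≠ 0 := by linarith
  have h4 : mm j ^ 2 - 1 = (mm j - 1) * (mm j + 1) := by ring
  rw [h4]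
  field_simp
  ring

theorem val_tau_bC (j : ℕ) : val 2 (tau^[j] bC) = BB j := by
  rw [val_tau_iter, val_bC (two_le_mm j), BB]

theorem bb_aux {m : ℝ} (h : 2 ≤ m) : 1/m < (m^4+m)/(m^5-1) := by
  have : 1 < m^5 := one_lt_pow₀ (by linarith) (by norm_num)
  rw [div_lt_div_iff₀ (by linarith) (by linarith)]
  nlinarith

theorem BB_gt (j : ℕ) : DD j / mm j * (1 - 1/(mm j - 1)) < 2 * BB j - 1 := by
  have h := two_le_mm j
  have h1 := bb_aux h
  have h2 := mul_lt_mul_of_pos_left h1 (DD_pos j)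
  have e : DD j / mm j * (1 - 1/(mm j - 1)) =
      2 * (DD j * (1/mm j) - DD j / (2*(mm j - 1))) := by
    have h1 : mm j - 1 ≠ 0 := by linarith
    have h2 : mm j ≠ 0 := by linarith
    field_simp
    ring
  rw [e, BB]
  linarith

theorem avoid_C (j : ℕ) {a b : ℝ} (ha : AA j ≤ a) (hb : b ≤ BB j) : Avoid a b := by
  have hm := two_le_mm j
  have hD := DD_pos j
  have hval := fun c => val_blk hm WC (show 0 < 12 by omega) c
      (fun b => ∑ i ∈ Finset.range 12, dg (WC b i) / mm j^(i+1)) (fun b => rfl)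
  have hpow : mm j ^ 12 = 2^(2^j*12) := by rw [mm, pow_mul]
  set P0 := ∑ i ∈ Finset.range 12, dg (WC false i) / mm j^(i+1) with hP0
  set P1 := ∑ i ∈ Finset.range 12, dg (WC true i) / mm j^(i+1) with hP1
  have hP : P1 - P0 ≠ 0 := by
    have : P1 - P0 = 1 / mm j^4 - 1/mm j^5 := by
      rw [hP0, hP1]
      simp [Finset.sum_range_succ, WC, dg]
    rw [this]
    have h1 : mm j - 1 ≠ 0 := by linarith
    have h2 : mm j ≠ 0 := by linarith
    have : 1 / mm j^4 - 1/mm j^5 = (mm j - 1) / mm j^5 := by field_simp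
    rw [this]
    positivity
  refine ⟨2^j*12, by have := Nat.one_le_two_pow (n := j); omega,
    1/2 - DD j / (2*(mm j - 1)) + DD j * (P0 * mm j^12/(mm j^12-1)),
    DD j * (mm j^12 * (P1 - P0)), ?_, fun c => ⟨tau^[j] (blk WC 12 c), ?_, fun n => ?_⟩⟩
  · have h2 : mm j ≠ 0 := by linarith
    exact mul_ne_zero hD.ne' (mul_ne_zero (pow_ne_zero _ h2) hP)
  · rw [val_tau_iter, hval c, ← hpow]
    ring
  · have hg := (good_C c).tau_iter (by simp [aC]) (by simp [aC]) (by simp [bC]) (by simp [bC]) j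
    refine hg.avoid ?_ ?_ ?_ ?_ n
    · rwa [val_tau_aC]
    · rwa [val_tau_bC]
    · rw [val_tau_aC, AA]
      have : 0 < DD j / (2*(mm j + 1)) := by positivity
      linarith
    · rw [val_tau_bC]
      have h1 := BB_gt j
      have : 0 ≤ DD j / mm j * (1 - 1/(mm j - 1)) := by
        apply mul_nonneg (by positivity)
        rw [sub_nonneg, div_le_one (by linarith)]
        linarith
      linarith

theorem DD_mm (j : ℕ) : DD (j+1) / mm (j+1) =
    (1/4) * ∏ i ∈ Finset.range j, (1 - (2:ℝ)⁻¹ ^ 2 ^ (i+1)) := by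
  induction j with
  | zero => norm_num [DD, mm]
  | succ j ih =>
    rw [Finset.prod_range_succ, ← mul_assoc, ← ih]
    have h := two_le_mm (j+1)
    have h2 : mm (j+1) ≠ 0 := by linarith
    rw [DD, mm_succ (j+1), inv_pow]
    change _ = _ * (1 - (mm (j+1))⁻¹)
    field_simp

theorem const_le (j : ℕ) : (1/4) * ∏' n : ℕ, (1 - (2:ℝ)⁻¹ ^ 2 ^ (n+1)) ≤ DD (j+1) / mm (j+1) := by
  rw [DD_mm]
  have hle : ∀ n : ℕ, (2:ℝ)⁻¹ ^ 2 ^ (n+1) ≤ 1 := fun n => pow_le_one₀ (by norm_num) (by norm_num)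
  have hs : Summable (fun n : ℕ => -(2:ℝ)⁻¹ ^ 2 ^ (n+1)) := by
    apply Summable.neg
    refine Summable.of_nonneg_of_le (fun n => by positivity) (fun n => ?_)
      (summable_geometric_of_lt_one (r := (2:ℝ)⁻¹) (by norm_num) (by norm_num))
    apply pow_le_pow_of_le_one (by norm_num) (by norm_num)
    exact (Nat.lt_two_pow_self (n := n+1)).le.trans' (by omega)
  have hm : Multipliable (fun n : ℕ => 1 - (2:ℝ)⁻¹ ^ 2 ^ (n+1)) := by
    simpa [sub_eq_add_neg] using Real.multipliable_one_add_of_summable hs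
  have ht := hm.hasProd.tendsto_prod_nat
  have hanti : Antitone (fun n : ℕ => ∏ i ∈ Finset.range n, (1 - (2:ℝ)⁻¹ ^ 2 ^ (i+1))) := by
    refine antitone_nat_of_succ_le fun n => ?_
    rw [Finset.prod_range_succ]
    apply mul_le_of_le_one_right
    · exact Finset.prod_nonneg fun i _ => by linarith [hle i]
    · have : (0:ℝ) ≤ (2:ℝ)⁻¹ ^ 2 ^ (n+1) := by positivity
      linarith
  have := hanti.le_of_tendsto ht j
  gcongr

theorem key_ineq (j : ℕ) : DD (j+3) / mm (j+3) ≤ BB j - AA (j+1) := by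
  have h := two_le_mm j
  have hD := DD_pos j
  simp only [BB, AA, DD, mm_succ]
  generalize mm j = m at *
  generalize DD j = D at *
  have h1 : 0 < m - 1 := by linarith
  have h2 : 0 < m := by linarith
  have h5 : 0 < m^4+m^3+m^2+m+1 := by positivity
  have e5 : m^5 - 1 = (m-1)*(m^4+m^3+m^2+m+1) := by ring
  rw [e5, ← sub_nonneg]
  have e : (1/2 - D / (2*(m - 1)) + D * ((m^4+m)/((m-1)*(m^4+m^3+m^2+m+1))) -
      (1/2 - D*(m-1) / (2*(m^2+1)))) - D * (m-1)*(m^2-1)*((m^2)^2-1)/((m^2)^2)^2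
      = D * (m^10 - m^9 - m^8 - m^6 - m^5 + 2*m^4 + m - 1) /
        ((m-1)*(m^4+m^3+m^2+m+1)*(m^2+1)*m^8) := by
    have h1' := h1.ne'
    have h5' := h5.ne'
    field_simp
    ring
  rw [e]
  have hN : 0 ≤ m^10 - m^9 - m^8 - m^6 - m^5 + 2*m^4 + m - 1 := by
    obtain ⟨t, rfl⟩ : ∃ t, m = t + 2 := ⟨m-2, by ring⟩
    have ht : 0 ≤ t := by linarith
    ring_nf
    positivity
  exact div_nonneg (mul_nonneg hD.le hN) (by positivity)

theorem mm_ge (j : ℕ) : (j:ℝ) + 1 ≤ mm j := by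
  have h1 : j + 1 ≤ 2^j := Nat.lt_two_pow_self
  have h2 : 2^j ≤ 2^(2^j) := (Nat.lt_two_pow_self (n := 2^j)).le
  unfold mm
  exact_mod_cast h1.trans h2

theorem stmt2_main (a b c : ℝ) (hc0 : 0 < c) (hc : ∀ j, c ≤ DD (j+1) / mm (j+1))
    (h : b - a < c) : Avoid a b := by
  have hc3 : c ≤ 45/256 := by
    have := hc 2
    norm_num [DD, mm] at this
    linarith
  rcases lt_or_ge b (1/2) with h1 | h1
  · exact avoid_A h1
  rcases lt_or_ge (1/2) a with h2 | h2
  · exact Avoid.flip' (avoid_A (by linarith))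
  rcases lt_or_ge a (1/3) with h3 | h3
  · exact avoid_B (by linarith) (by linarith)
  rcases lt_or_ge (1-b) (1/3) with h4 | h4
  · exact Avoid.flip' (avoid_B (by linarith) (by linarith))
  by_contra hno
  have hno' : ¬ Avoid (1-b) (1-a) := fun h => hno h.flip'
  have key : ∀ k, AA k ≤ a ∧ AA k ≤ 1 - b := by
    intro k
    induction k with
    | zero =>
      have : AA 0 = 1/3 := by norm_num [AA, DD, mm]
      rw [this]
      exact ⟨h3, h4⟩
    | succ k ih =>
      have hk := key_ineq k
      have hk' := hc (k+2)
      constructor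
      · by_contra! hh
        exact hno (avoid_C k ih.1 (by linarith))
      · by_contra! hh
        exact hno' (avoid_C k ih.2 (by linarith))
  obtain ⟨n, hn⟩ := exists_nat_gt (c / (c - (b-a)))
  have hbk := BB_gt (n+1)
  have hcn := hc n
  have hm := mm_ge (n+1)
  push_cast at hm
  have h0 : 0 < c - (b-a) := by linarith
  have hn0 : (0:ℝ) < n + 1 := by positivity
  have h5 : 1 / (mm (n+1) - 1) ≤ 1/(n+1) := one_div_le_one_div_of_le hn0 (by linarith)
  have h6 : (1:ℝ)/(n+1) ≤ 1 := by rw [div_le_one hn0]; linarith [(Nat.cast_nonneg n : (0:ℝ) ≤ n)]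
  have h7 : c * (1 - 1/(n+1)) ≤ DD (n+1) / mm (n+1) * (1 - 1/(mm (n+1) - 1)) := by
    apply mul_le_mul hcn (by linarith) (by linarith) (by linarith)
  have h8 : c * (1/(n+1)) ≤ c - (b-a) := by
    rw [div_lt_iff₀ h0] at hn
    rw [mul_one_div, div_le_iff₀ hn0]
    nlinarith
  have h9 : b - a < 2 * BB (n+1) - 1 := by linarith
  rcases le_or_gt b (BB (n+1)) with h10 | h10
  · exact hno (avoid_C (n+1) (key _).1 h10)
  · exact hno' (avoid_C (n+1) (key _).2 (by linarith))

theorem stmt2 (a b : ℝ) (ha : 0 < a) (hab : a < b) (hb : b < 1)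
    (h : b - a < (1/4) * ∏' n : ℕ, (1 - (2:ℝ)⁻¹ ^ 2 ^ (n+1))) :
    0 < dimH (J a b) :=
  (stmt2_main a b _ (by linarith) const_le h).dim

end
end

section
/- For every (a,b) with a ∈ (0,1/2) and b ∈ (1/2,1): dim_H 𝒥(a,b) > 0 if and only if b < χ(a). -/
noncomputable section

namespace DM

def sh (n : ℕ) (w : ℕ → Bool) : ℕ → Bool := fun k => w (n + k)

def dg (c : Bool) : ℝ := if c then 1 else 0

def pre (m : ℕ) (u z : ℕ → Bool) : ℕ → Bool := fun k => if k < m then u k else z (k - m)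

lemma dg_nonneg (c : Bool) : 0 ≤ dg c := by unfold dg; split_ifs <;> norm_num
lemma dg_le (c : Bool) : dg c ≤ 1 := by unfold dg; split_ifs <;> norm_num

lemma sh_zero (w : ℕ → Bool) : sh 0 w = w := by funext k; simp [sh]
lemma sh_sh (n m : ℕ) (w : ℕ → Bool) : sh n (sh m w) = sh (m + n) w := by
  funext k; simp [sh, Nat.add_assoc]

lemma sh_pre_ge {m n : ℕ} (h : m ≤ n) (u z : ℕ → Bool) : sh n (pre m u z) = sh (n - m) z := by
  funext k
  have h1 : ¬ (n + k < m) := by omega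
  have h2 : n + k - m = n - m + k := by omega
  simp [sh, pre, h1, h2]

lemma geo_summable : Summable (fun n : ℕ => (1:ℝ) / 2 ^ (n+1)) := by
  have := summable_geometric_two.mul_left (1/2 : ℝ)
  refine this.congr (fun n => ?_)
  rw [pow_succ, div_pow]; field_simp; simp

lemma geo_tsum : ∑' n : ℕ, (1:ℝ) / 2 ^ (n+1) = 1 := by
  have h : ∀ n : ℕ, (1:ℝ) / 2 ^ (n+1) = (1/2) * (1/2)^n := by
    intro n; rw [pow_succ, div_pow]; field_simp; simp
  simp_rw [h]
  rw [tsum_mul_left, tsum_geometric_two]; norm_num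

lemma term_nonneg (w : ℕ → Bool) (n : ℕ) : 0 ≤ (if w n then (1:ℝ) else 0) / 2 ^ (n+1) := by
  split_ifs <;> positivity

lemma term_le (w : ℕ → Bool) (n : ℕ) :
    (if w n then (1:ℝ) else 0) / 2 ^ (n+1) ≤ 1 / 2 ^ (n+1) := by
  gcongr; split_ifs <;> norm_num

lemma pi_summable (w : ℕ → Bool) :
    Summable (fun n : ℕ => (if w n then (1:ℝ) else 0) / 2 ^ (n+1)) :=
  Summable.of_nonneg_of_le (term_nonneg w) (term_le w) geo_summable

lemma pi_nonneg (w : ℕ → Bool) : 0 ≤ piMap w := tsum_nonneg (term_nonneg w)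

lemma pi_le_one (w : ℕ → Bool) : piMap w ≤ 1 := by
  rw [← geo_tsum]
  exact (pi_summable w).tsum_le_tsum (term_le w) geo_summable

lemma pi_rec (w : ℕ → Bool) : piMap w = (dg (w 0) + piMap (sh 1 w)) / 2 := by
  unfold piMap
  rw [(pi_summable w).tsum_eq_zero_add]
  have : ∀ n : ℕ, (if w (n+1) then (1:ℝ) else 0) / 2 ^ (n+1+1)
      = (1/2) * ((if sh 1 w n then (1:ℝ) else 0) / 2 ^ (n+1)) := by
    intro n
    simp only [sh, Nat.add_comm 1 n]
    rw [pow_succ 2 (n+1)]; field_simp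
  simp_rw [this]
  rw [tsum_mul_left]
  simp [dg]; ring

lemma pi_rec_sh (w : ℕ → Bool) (m : ℕ) :
    piMap (sh m w) = (dg (w m) + piMap (sh (m+1) w)) / 2 := by
  rw [pi_rec (sh m w), sh_sh]; simp [sh]

/-- lower endpoint of the dyadic interval of the first `m` letters -/
def lo (w : ℕ → Bool) (m : ℕ) : ℝ := piMap w - piMap (sh m w) / 2 ^ m

lemma lo_zero (w : ℕ → Bool) : lo w 0 = 0 := by simp [lo, sh_zero]

lemma lo_succ (w : ℕ → Bool) (m : ℕ) : lo w (m+1) = lo w m + dg (w m) / 2 ^ (m+1) := by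
  unfold lo
  rw [pi_rec_sh w m, pow_succ]; field_simp; ring

lemma lo_congr {w w' : ℕ → Bool} {m : ℕ} (h : ∀ k < m, w k = w' k) : lo w m = lo w' m := by
  induction m with
  | zero => simp [lo_zero]
  | succ m ih =>
    rw [lo_succ, lo_succ, ih (fun k hk => h k (by omega)), h m (by omega)]

lemma lo_le (w : ℕ → Bool) (m : ℕ) : lo w m ≤ piMap w := by
  have := pi_nonneg (sh m w)
  have : 0 ≤ piMap (sh m w) / 2 ^ m := by positivity
  unfold lo; linarith

lemma le_hi (w : ℕ → Bool) (m : ℕ) : piMap w ≤ lo w m + 1 / 2 ^ m := by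
  have h := pi_le_one (sh m w)
  have : piMap (sh m w) / 2 ^ m ≤ 1 / 2 ^ m := by gcongr
  unfold lo; linarith

lemma lo_mono_succ (w : ℕ → Bool) (m : ℕ) : lo w m ≤ lo w (m+1) := by
  rw [lo_succ]
  have := dg_nonneg (w m)
  have : 0 ≤ dg (w m) / 2 ^ (m+1) := by positivity
  linarith

lemma hi_anti_succ (w : ℕ → Bool) (m : ℕ) :
    lo w (m+1) + 1 / 2 ^ (m+1) ≤ lo w m + 1 / 2 ^ m := by
  rw [lo_succ]
  have := dg_le (w m)
  have h : dg (w m) / 2 ^ (m+1) ≤ 1 / 2 ^ (m+1) := by gcongr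
  have h2 : (1:ℝ) / 2 ^ m = 1 / 2 ^ (m+1) + 1 / 2 ^ (m+1) := by rw [pow_succ]; field_simp; norm_num
  linarith

lemma lo_mono (w : ℕ → Bool) : Monotone (lo w) := monotone_nat_of_le_succ (lo_mono_succ w)

lemma hi_anti (w : ℕ → Bool) : Antitone (fun m => lo w m + 1 / 2 ^ m) :=
  antitone_nat_of_succ_le (hi_anti_succ w)

/-- agreeing on first m letters -/
lemma pi_close {w w' : ℕ → Bool} {m : ℕ} (h : ∀ k < m, w k = w' k) :
    |piMap w - piMap w'| ≤ 1 / 2 ^ m := by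
  have h1 := lo_congr h
  have := lo_le w m; have := lo_le w' m; have := le_hi w m; have := le_hi w' m
  rw [abs_le]; constructor <;> linarith

lemma pi_diff {w w' : ℕ → Bool} {m : ℕ} (h : ∀ k < m, w k = w' k) :
    piMap w - piMap w' = (piMap (sh m w) - piMap (sh m w')) / 2 ^ m := by
  have h1 := lo_congr h
  unfold lo at h1
  rw [sub_div]; linarith

lemma pi_pre (m : ℕ) (u z : ℕ → Bool) : piMap (pre m u z) = lo u m + piMap z / 2 ^ m := by
  have h1 : lo (pre m u z) m = lo u m := lo_congr (fun k hk => by simp [pre, hk])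
  rw [← h1]; unfold lo
  rw [sh_pre_ge le_rfl]; simp [sh_zero]

lemma pi_half_of_false {w : ℕ → Bool} (h : w 0 = false) : piMap w ≤ 1/2 := by
  rw [pi_rec, h]; have := pi_le_one (sh 1 w); simp [dg]; linarith

lemma pi_half_of_true {w : ℕ → Bool} (h : w 0 = true) : 1/2 ≤ piMap w := by
  rw [pi_rec, h]; have := pi_nonneg (sh 1 w); simp [dg]; linarith

/-- symbolic survivor set -/
def XX (a b : ℝ) : Set (ℕ → Bool) := {w | ∀ n, piMap (sh n w) ≤ a ∨ b ≤ piMap (sh n w)}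

lemma XX_sh {a b : ℝ} {w : ℕ → Bool} (h : w ∈ XX a b) (n : ℕ) : sh n w ∈ XX a b := by
  intro k; rw [sh_sh]; exact h _

lemma XX_mono {a b b' : ℝ} (hb : b ≤ b') : XX a b' ⊆ XX a b := by
  intro w h n
  rcases h n with h | h
  · exact Or.inl h
  · exact Or.inr (hb.trans h)

lemma XX_false {a b : ℝ} (hb : 1/2 < b) {w : ℕ → Bool} (hw : w ∈ XX a b) {n : ℕ}
    (h : w n = false) : piMap (sh n w) ≤ a := by
  rcases hw n with h1 | h1
  · exact h1
  · have := pi_half_of_false (w := sh n w) (by simpa [sh] using h)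
    linarith

lemma XX_true {a b : ℝ} (ha : a < 1/2) {w : ℕ → Bool} (hw : w ∈ XX a b) {n : ℕ}
    (h : w n = true) : b ≤ piMap (sh n w) := by
  rcases hw n with h1 | h1
  · have := pi_half_of_true (w := sh n w) (by simpa [sh] using h)
    linarith
  · exact h1

/-- separation -/
lemma XX_sep {a b : ℝ} (ha : a < 1/2) (hb : 1/2 < b) {w w' : ℕ → Bool} (hw : w ∈ XX a b)
    (hw' : w' ∈ XX a b) {n : ℕ} (hagree : ∀ k < n, w k = w' k) (hne : w n ≠ w' n) :
    (b - a) / 2 ^ n ≤ |piMap w - piMap w'| := by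
  rw [pi_diff hagree, abs_div, abs_of_pos (by positivity : (0:ℝ) < 2 ^ n)]
  gcongr
  cases h : w n <;> cases h' : w' n
  · simp [h, h'] at hne
  · have := XX_false hb hw h; have := XX_true ha hw' h'
    rw [abs_sub_comm]; exact le_trans (by linarith) (le_abs_self _)
  · have := XX_true ha hw h; have := XX_false hb hw' h'
    exact le_trans (by linarith) (le_abs_self _)
  · simp [h, h'] at hne

lemma first_diff {w w' : ℕ → Bool} (h : w ≠ w') : ∃ n, (∀ k < n, w k = w' k) ∧ w n ≠ w' n := by
  classical
  have h1 : ∃ n, w n ≠ w' n := by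
    by_contra hc; push Not at hc; exact h (funext hc)
  refine ⟨Nat.find h1, fun k hk => ?_, Nat.find_spec h1⟩
  have := Nat.find_min h1 hk
  simpa using this

lemma pi_inj {a b : ℝ} (ha : a < 1/2) (hb : 1/2 < b) : Set.InjOn piMap (XX a b) := by
  intro w hw w' hw' h
  by_contra hne
  obtain ⟨n, h1, h2⟩ := first_diff hne
  have := XX_sep ha hb hw hw' h1 h2
  rw [h, sub_self, abs_zero] at this
  have h3 : 0 < (b - a) / 2 ^ n := by apply div_pos; linarith; positivity
  linarith

lemma Dbl_mem {x : ℝ} (hx : x ∈ Set.Icc (0:ℝ) 1) : Dbl x ∈ Set.Icc (0:ℝ) 1 := by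
  unfold Dbl
  obtain ⟨h1, h2⟩ := hx
  split_ifs with h
  · constructor <;> linarith
  · push Not at h; constructor <;> linarith

lemma Dbl_iter_mem {x : ℝ} (hx : x ∈ Set.Icc (0:ℝ) 1) (n : ℕ) : Dbl^[n] x ∈ Set.Icc (0:ℝ) 1 := by
  induction n with
  | zero => exact hx
  | succ n ih => rw [Function.iterate_succ_apply']; exact Dbl_mem ih

open Classical in
def itin (x : ℝ) : ℕ → Bool := fun n => decide (1/2 < Dbl^[n] x)

lemma sh_itin (x : ℝ) (n : ℕ) : sh n (itin x) = itin (Dbl^[n] x) := by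
  funext k
  simp only [sh, itin]
  rw [← Function.iterate_add_apply, Nat.add_comm]

lemma Dbl_itin (x : ℝ) : x = (dg (itin x 0) + Dbl x) / 2 := by
  simp only [itin, Function.iterate_zero, id, dg, Dbl]
  by_cases h : x ≤ 1/2
  · have h' : ¬ (1/2 < x) := by linarith
    simp only [h', h, decide_false, if_true]; simp
  · have h' : (1/2 < x) := by linarith
    simp only [h', h, decide_true, if_true, if_false]; ring

lemma pi_itin_aux (n : ℕ) : ∀ x ∈ Set.Icc (0:ℝ) 1, |piMap (itin x) - x| ≤ 1 / 2 ^ n := by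
  induction n with
  | zero =>
    intro x hx
    have := pi_nonneg (itin x); have := pi_le_one (itin x)
    rw [abs_le]; constructor <;> simp <;> linarith [hx.1, hx.2]
  | succ n ih =>
    intro x hx
    have h1 := ih _ (Dbl_mem hx)
    have h2 := Dbl_itin x
    have h3 := pi_rec (itin x)
    rw [sh_itin x 1] at h3
    have h4 : piMap (itin x) - x = (piMap (itin (Dbl x)) - Dbl x) / 2 := by
      simp only [Function.iterate_one] at h3; linarith
    rw [h4, abs_div, abs_two, pow_succ, ← div_div]
    gcongr

lemma pi_itin {x : ℝ} (hx : x ∈ Set.Icc (0:ℝ) 1) : piMap (itin x) = x := by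
  by_contra hne
  have h0 : 0 < |piMap (itin x) - x| := abs_pos.mpr (sub_ne_zero.mpr hne)
  obtain ⟨n, hn⟩ := exists_pow_lt_of_lt_one h0 (by norm_num : (1/2:ℝ) < 1)
  have := pi_itin_aux n x hx
  rw [div_pow, one_pow] at hn
  linarith

lemma Dbl_pi {a b : ℝ} (ha : a < 1/2) (hb : 1/2 < b) {w : ℕ → Bool} (hw : w ∈ XX a b) :
    Dbl (piMap w) = piMap (sh 1 w) := by
  have h3 := pi_rec w
  cases h : w 0
  · have := XX_false hb hw h
    rw [sh_zero] at this
    unfold Dbl; rw [if_pos (by linarith)]; rw [h] at h3; simp [dg] at h3; linarith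
  · have := XX_true ha hw h
    rw [sh_zero] at this
    unfold Dbl; rw [if_neg (by linarith)]; rw [h] at h3; simp [dg] at h3; linarith

lemma Dbl_iter_pi {a b : ℝ} (ha : a < 1/2) (hb : 1/2 < b) {w : ℕ → Bool} (hw : w ∈ XX a b)
    (n : ℕ) : Dbl^[n] (piMap w) = piMap (sh n w) := by
  induction n with
  | zero => simp [sh_zero]
  | succ n ih => rw [Function.iterate_succ_apply', ih, Dbl_pi ha hb (XX_sh hw n), sh_sh]

lemma J_eq {a b : ℝ} (ha : a < 1/2) (hb : 1/2 < b) : J a b = piMap '' XX a b := by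
  ext x; constructor
  · rintro ⟨hx, h⟩
    refine ⟨itin x, fun n => ?_, pi_itin hx⟩
    rw [sh_itin, pi_itin (Dbl_iter_mem hx n)]
    have := h n
    simp only [Set.mem_Ioo, not_and, not_lt] at this
    by_cases h1 : Dbl^[n] x ≤ a
    · exact Or.inl h1
    · exact Or.inr (this (by linarith))
  · rintro ⟨w, hw, rfl⟩
    refine ⟨⟨pi_nonneg w, pi_le_one w⟩, fun n => ?_⟩
    rw [Dbl_iter_pi ha hb hw]
    rintro ⟨h1, h2⟩
    rcases hw n with h | h <;> linarith

end DM

namespace DM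

lemma pre_pre (m m' : ℕ) (u u' z z0 : ℕ → Bool) :
    pre m u (pre m' u' z) = pre (m + m') (pre m u (pre m' u' z0)) z := by
  funext k
  simp only [pre]
  by_cases h1 : k < m
  · have : k < m + m' := by omega
    simp [h1, this]
  · by_cases h2 : k - m < m'
    · have : k < m + m' := by omega
      simp [h1, h2, this]
    · have : ¬ k < m + m' := by omega
      have h3 : k - m - m' = k - (m + m') := by omega
      simp [h1, h2, this, h3]

/-- two noncommuting words leaving a nonempty subset of the survivor set invariant -/
def Horse (a b : ℝ) : Prop :=
  ∃ (m : ℕ) (u : ℕ → Bool) (m' : ℕ) (u' : ℕ → Bool),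
    (∃ z, pre m u (pre m' u' z) ≠ pre m' u' (pre m u z)) ∧
    ∃ K : Set (ℕ → Bool), K.Nonempty ∧ K ⊆ XX a b ∧ ∀ z ∈ K, pre m u z ∈ K ∧ pre m' u' z ∈ K

def SS (l : ℕ) (A B : ℕ → Bool) (e : ℕ → Bool) : ℕ → Bool :=
  fun n => if e (n / l) then B (n % l) else A (n % l)

lemma XX_closed {a b : ℝ} {w : ℕ → Bool}
    (h : ∀ N : ℕ, ∃ y ∈ XX a b, ∀ k < N, y k = w k) : w ∈ XX a b := by
  intro n
  by_contra hc
  push Not at hc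
  obtain ⟨h1, h2⟩ := hc
  have h0 : 0 < min (piMap (sh n w) - a) (b - piMap (sh n w)) := by
    apply lt_min <;> linarith
  obtain ⟨N, hN⟩ := exists_pow_lt_of_lt_one h0 (by norm_num : (1/2:ℝ) < 1)
  obtain ⟨y, hy, hyw⟩ := h (n + N)
  have h3 := pi_close (w := sh n y) (w' := sh n w) (m := N)
    (fun k hk => hyw (n + k) (by omega))
  rw [div_pow, one_pow, lt_min_iff] at hN
  rw [abs_le] at h3
  rcases hy n with h | h <;> linarith [h3.1, h3.2, hN.1, hN.2]

lemma horse_normal {a b : ℝ} (h : Horse a b) :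
    ∃ l : ℕ, 0 < l ∧ ∃ A B : ℕ → Bool, (∃ j < l, (∀ i < j, A i = B i) ∧ A j ≠ B j) ∧
      ∀ e, SS l A B e ∈ XX a b := by
  obtain ⟨m, u, m', u', ⟨z0, hz0⟩, K, ⟨y0, hy0⟩, hKX, hK⟩ := h
  obtain ⟨j, hj1, hj2⟩ := first_diff hz0
  have hjl : j < m + m' := by
    by_contra hc
    apply hj2
    rw [pre_pre m m' u u' z0 z0, pre_pre m' m u' u z0 z0]
    have h1 : ¬ j < m' + m := by omega
    simp only [pre, hc, h1, if_false]
    rw [Nat.add_comm]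
  set l := m + m' with hl
  set A := pre m u (pre m' u' z0) with hA
  set B := pre m' u' (pre m u z0) with hB
  refine ⟨l, by omega, A, B, ⟨j, hjl, hj1, hj2⟩, fun e => XX_closed (fun N => ?_)⟩
  have hKA : ∀ z ∈ K, pre l A z ∈ K := by
    intro z hz
    rw [hl, hA, ← pre_pre]
    exact (hK _ (hK _ hz).2).1
  have hKB : ∀ z ∈ K, pre l B z ∈ K := by
    intro z hz
    rw [hl, hB, Nat.add_comm m m', ← pre_pre]
    exact (hK _ (hK _ hz).1).2
  have key : ∀ r : ℕ, ∀ e : ℕ → Bool, ∃ y ∈ K, ∀ k < r * l, y k = SS l A B e k := by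
    intro r
    induction r with
    | zero => intro e; exact ⟨y0, hy0, fun k hk => by omega⟩
    | succ r ih =>
      intro e
      obtain ⟨y, hy, hye⟩ := ih (fun k => e (k + 1))
      refine ⟨pre l (if e 0 then B else A) y, ?_, ?_⟩
      · split_ifs
        · exact hKB y hy
        · exact hKA y hy
      · intro k hk
        by_cases hkl : k < l
        · have h1 : k / l = 0 := Nat.div_eq_of_lt hkl
          have h2 : k % l = k := Nat.mod_eq_of_lt hkl
          simp only [pre, hkl, if_true, SS, h1, h2]
          split_ifs <;> rfl
        · have h1 : k / l = (k - l) / l + 1 := by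
            rw [Nat.div_eq_sub_div (by omega) (by omega)]
          have h2 : k % l = (k - l) % l := by
            rw [Nat.mod_eq_sub_mod (by omega)]
          have h3 : k - l < r * l := by
            have : (r + 1) * l = r * l + l := by ring
            omega
          have := hye (k - l) h3
          simp only [pre, hkl, if_false, this, SS, h1, h2]
  obtain ⟨y, hy, hye⟩ := key N e
  refine ⟨y, hKX hy, fun k hk => hye k ?_⟩
  have : N * 1 ≤ N * l := Nat.mul_le_mul_left N (by omega)
  omega

lemma SS_agree {l : ℕ} {A B e e' : ℕ → Bool} {j k : ℕ}
    (hAB : ∀ i < j, A i = B i) (he : ∀ i < k, e i = e' i) :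
    ∀ i < k * l + j, (i / l < k ∨ i / l = k) → SS l A B e i = SS l A B e' i := by
  intro i hi h
  rcases h with h | h
  · simp [SS, he _ h]
  · have h1 : i % l < j := by
      have := Nat.div_add_mod i l
      rw [h, Nat.mul_comm] at this
      omega
    simp only [SS, hAB _ h1]
    split_ifs <;> rfl

lemma SS_at {l : ℕ} {A B e : ℕ → Bool} {j k : ℕ} (hj : j < l) :
    SS l A B e (k * l + j) = if e k then B j else A j := by
  have h1 : (k * l + j) / l = k := by
    rw [Nat.mul_comm, Nat.mul_add_div (by omega), Nat.div_eq_of_lt hj, Nat.add_zero]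
  have h2 : (k * l + j) % l = j := by
    rw [Nat.mul_comm, Nat.mul_add_mod, Nat.mod_eq_of_lt hj]
  simp only [SS, h1, h2]

lemma SS_diff {l : ℕ} {A B e e' : ℕ → Bool} {j k : ℕ} (hj : j < l)
    (hAB : ∀ i < j, A i = B i) (hne : A j ≠ B j) (he : ∀ i < k, e i = e' i) (hek : e k ≠ e' k) :
    (∀ i < k * l + j, SS l A B e i = SS l A B e' i) ∧
      SS l A B e (k * l + j) ≠ SS l A B e' (k * l + j) := by
  constructor
  · intro i hi
    refine SS_agree hAB he i hi ?_
    have h1 : i < (k + 1) * l := by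
      have : (k + 1) * l = k * l + l := by ring
      omega
    have := (Nat.div_lt_iff_lt_mul (by omega : 0 < l)).2 h1
    omega
  · rw [SS_at hj, SS_at hj]
    cases h1 : e k <;> cases h2 : e' k <;> simp_all
    exact fun h => hne h.symm

lemma SS_inj {l : ℕ} {A B : ℕ → Bool} {j : ℕ} (hj : j < l)
    (hAB : ∀ i < j, A i = B i) (hne : A j ≠ B j) : Function.Injective (SS l A B) := by
  intro e e' h
  by_contra hc
  obtain ⟨k, h1, h2⟩ := first_diff hc
  exact (SS_diff hj hAB hne h1 h2).2 (by rw [h])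

/-- A horseshoe gives positive dimension. -/
lemma horse_dim {a b : ℝ} (ha : a < 1/2) (hb : 1/2 < b) (h : Horse a b) : 0 < dimH (J a b) := by
  obtain ⟨l, hl, A, B, ⟨j, hj, hAB, hne⟩, hS⟩ := horse_normal h
  set g : (ℕ → Bool) → ℝ := fun e => piMap (SS l A B e) with hg
  have hgi : Function.Injective g := by
    intro e e' he
    exact SS_inj hj hAB hne (pi_inj ha hb (hS e) (hS e') he)
  set f : ℝ → ℝ := fun x => piMap (Function.invFun g x) with hf
  have hfg : ∀ e, f (g e) = piMap e := by
    intro e; simp only [hf]; rw [Function.leftInverse_invFun hgi e]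
  set s := Set.range g with hs
  have hsJ : s ⊆ J a b := by
    rw [J_eq ha hb]
    rintro _ ⟨e, rfl⟩
    exact ⟨_, hS e, rfl⟩
  have him : f '' s = Set.Icc 0 1 := by
    ext x; constructor
    · rintro ⟨_, ⟨e, rfl⟩, rfl⟩
      rw [hfg]; exact ⟨pi_nonneg _, pi_le_one _⟩
    · intro hx
      exact ⟨g (itin x), ⟨_, rfl⟩, by rw [hfg, pi_itin hx]⟩
  have hba : 0 < b - a := by linarith
  set C0 : ℝ := (2 ^ l / (b - a)) ^ (1 / (l:ℝ)) with hC0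
  have hC0' : 0 ≤ C0 := by positivity
  set r : NNReal := ⟨1 / (l:ℝ), by positivity⟩ with hr
  have hrpos : 0 < r := by
    rw [← NNReal.coe_pos]; show (0:ℝ) < 1 / (l:ℝ); positivity
  have hreal : ∀ e e', dist (piMap e) (piMap e') ≤ C0 * dist (g e) (g e') ^ (1 / (l:ℝ)) := by
    intro e e'
    by_cases hee : e = e'
    · subst hee; simp; positivity
    obtain ⟨k, h1, h2⟩ := first_diff hee
    have h3 := SS_diff hj hAB hne h1 h2
    have h4 := XX_sep ha hb (hS e) (hS e') h3.1 h3.2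
    have h5 := pi_close h1
    rw [Real.dist_eq, Real.dist_eq]
    set d := |g e - g e'| with hd
    have h6 : (b - a) / 2 ^ (k * l + l) ≤ d := by
      refine le_trans ?_ h4
      gcongr
      · norm_num
    rw [hC0, ← Real.mul_rpow (by positivity) (by positivity)]
    have h7 : ((1:ℝ) / 2 ^ k) ^ l ≤ 2 ^ l / (b - a) * d := by
      calc ((1:ℝ) / 2 ^ k) ^ l = 2 ^ l / (b - a) * ((b - a) / 2 ^ (k * l + l)) := by
            rw [div_pow, one_pow, ← pow_mul, pow_add]; field_simp
        _ ≤ _ := by gcongr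
    calc _ ≤ (1:ℝ) / 2 ^ k := h5
      _ = (((1:ℝ) / 2 ^ k) ^ l) ^ (1 / (l:ℝ)) := by
          rw [one_div (l:ℝ), Real.pow_rpow_inv_natCast (by positivity) (by omega)]
      _ ≤ _ := by gcongr
  have hol : HolderOnWith C0.toNNReal r f s := by
    rintro _ ⟨e, rfl⟩ _ ⟨e', rfl⟩
    rw [hfg, hfg, edist_dist, edist_dist]
    have h1 : ((C0.toNNReal : NNReal) : ENNReal) = ENNReal.ofReal C0 := rfl
    rw [h1, ENNReal.ofReal_rpow_of_nonneg dist_nonneg (by positivity), ← ENNReal.ofReal_mul hC0']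
    exact ENNReal.ofReal_le_ofReal (hreal e e')
  have hd := hol.dimH_image_le hrpos
  rw [him] at hd
  have h1 : dimH (Set.Icc (0:ℝ) 1) = 1 := by
    have := Real.dimH_of_nonempty_interior (s := Set.Icc (0:ℝ) 1)
      (by rw [interior_Icc]; exact ⟨1/2, by norm_num, by norm_num⟩)
    rw [this]; simp
  rw [h1] at hd
  by_contra hc
  have h2 : dimH s = 0 := by
    have := dimH_mono hsJ
    have h3 : dimH (J a b) = 0 := by simpa using hc
    rw [h3] at this; simpa using this
  rw [h2] at hd
  simp at hd

lemma not_countable_cantor : ¬ Countable (ℕ → Bool) := by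
  rw [not_countable_iff, ← Cardinal.aleph0_lt_mk_iff]
  simpa using Cardinal.aleph0_lt_continuum

lemma horse_uncount_aux {a b : ℝ} (ha : a < 1/2) (hb : 1/2 < b) (hb1 : b < 1) {l : ℕ}
    {A B : ℕ → Bool} {j : ℕ} (hj : j < l) (hAB : ∀ i < j, A i = B i)
    (hA : A j = false) (hB : B j = true) (hS : ∀ e, SS l A B e ∈ XX a b) :
    ∃ b', b < b' ∧ b' < 1 ∧ ¬ (J a b').Countable := by
  have hba : 0 < b - a := by linarith
  have hd : 0 < (b - a) / 2 ^ (3 * l) := by positivity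
  set δ := (b - a) / 2 ^ (3 * l) with hδ
  have hne : A j ≠ B j := by simp [hA, hB]
  have key : ∀ e : ℕ → Bool, (∀ k, e (2 * k + 1) = true) → SS l A B e ∈ XX a (b + δ) := by
    intro e he n
    obtain ⟨k, hk1, hk2, hk3⟩ : ∃ k, n / l < k ∧ k ≤ n / l + 2 ∧ e k = true := by
      rcases Nat.even_or_odd' (n / l) with ⟨c, hc | hc⟩
      · exact ⟨2 * c + 1, by omega, by omega, he c⟩
      · exact ⟨2 * (c + 1) + 1, by omega, by omega, he _⟩
    have hnp : n < k * l := by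
      exact (Nat.div_lt_iff_lt_mul (by omega : 0 < l)).1 hk1
    have hpn : k * l + j ≤ n + 3 * l := by
      have h1 : k * l ≤ (n / l + 2) * l := Nat.mul_le_mul_right _ hk2
      have h2 : n / l * l ≤ n := Nat.div_mul_le_self n l
      have h3 : (n / l + 2) * l = n / l * l + 2 * l := by ring
      omega
    set e' := Function.update e k false with he'
    have h1 : ∀ i < k, e i = e' i := by
      intro i hi; rw [he', Function.update_of_ne (by omega)]
    have h2 : e' k = false := by simp [he']
    have h3 := SS_diff hj hAB hne h1 (by rw [hk3, h2]; simp)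
    set p := k * l + j with hp
    have h4 : SS l A B e p = true := by rw [hp, SS_at hj, hk3]; simpa using hB
    have h5 : SS l A B e' p = false := by rw [hp, SS_at hj, h2]; simpa using hA
    have h6 := XX_true ha (hS e) h4
    have h7 := XX_false hb (hS e') h5
    have h8 := pi_diff (w := sh n (SS l A B e)) (w' := sh n (SS l A B e')) (m := p - n)
      (fun i hi => h3.1 (n + i) (by omega))
    rw [sh_sh, sh_sh, show n + (p - n) = p by omega] at h8
    cases h9 : SS l A B e n
    · exact Or.inl (XX_false hb (hS e) h9)
    · right
      have h10 : SS l A B e' n = true := by rw [← h3.1 n (by omega)]; exact h9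
      have h11 := XX_true ha (hS e') h10
      have h12 : δ ≤ (piMap (sh p (SS l A B e)) - piMap (sh p (SS l A B e'))) / 2 ^ (p - n) := by
        have : p - n ≤ 3 * l := by omega
        rw [hδ]
        gcongr
        · linarith
        · norm_num
      linarith
  refine ⟨min (b + δ) ((b + 1) / 2), ?_, ?_, ?_⟩
  · apply lt_min <;> linarith
  · exact lt_of_le_of_lt (min_le_right _ _) (by linarith)
  · intro hc
    have hb' : 1/2 < min (b + δ) ((b + 1) / 2) := by apply lt_min <;> linarith
    rw [J_eq ha hb'] at hc
    set E : (ℕ → Bool) → (ℕ → Bool) := fun η k => if k % 2 = 1 then true else η (k / 2) with hE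
    have hEi : Function.Injective E := by
      intro η η' h
      funext k
      have := congrFun h (2 * k)
      simpa [hE] using this
    have hEo : ∀ η k, E η (2 * k + 1) = true := by
      intro η k
      have : (2 * k + 1) % 2 = 1 := by omega
      simp [hE]
    have hmem : ∀ η, SS l A B (E η) ∈ XX a (min (b + δ) ((b + 1) / 2)) := fun η =>
      XX_mono (min_le_left _ _) (key _ (hEo η))
    have : Countable ↥(piMap '' XX a (min (b + δ) ((b + 1) / 2))) := hc.to_subtype
    let F : (ℕ → Bool) → ↥(piMap '' XX a (min (b + δ) ((b + 1) / 2))) :=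
      fun η => ⟨piMap (SS l A B (E η)), _, hmem η, rfl⟩
    have hF : Function.Injective F := by
      intro η η' h
      have h1 : piMap (SS l A B (E η)) = piMap (SS l A B (E η')) := congrArg Subtype.val h
      exact hEi (SS_inj hj hAB hne (pi_inj ha hb' (hmem η) (hmem η') h1))
    have hcount : Countable (ℕ → Bool) := hF.countable
    exact not_countable_cantor hcount

lemma SS_swap (l : ℕ) (A B e : ℕ → Bool) : SS l B A e = SS l A B (fun k => !(e k)) := by
  funext n; simp only [SS]; by_cases h : e (n / l) = true <;> simp [h]

lemma horse_uncount {a b : ℝ} (ha : a < 1/2) (hb : 1/2 < b) (hb1 : b < 1) (h : Horse a b) :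
    ∃ b', b < b' ∧ b' < 1 ∧ ¬ (J a b').Countable := by
  obtain ⟨l, hl, A, B, ⟨j, hj, hAB, hne⟩, hS⟩ := horse_normal h
  cases hA : A j <;> cases hB : B j
  · simp [hA, hB] at hne
  · exact horse_uncount_aux ha hb hb1 hj hAB hA hB hS
  · exact horse_uncount_aux ha hb hb1 hj (fun i hi => (hAB i hi).symm) hB hA
      (fun e => by rw [SS_swap]; exact hS _)
  · simp [hA, hB] at hne

end DM

namespace DM

/-- eventually periodic -/
def EP (w : ℕ → Bool) : Prop := ∃ s t, s < t ∧ sh s w = sh t w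

lemma EP_countable : {w | EP w}.Countable := by
  have h : {w | EP w} ⊆ ⋃ p : {p : ℕ × ℕ // p.1 < p.2}, {w | sh p.1.1 w = sh p.1.2 w} := by
    rintro w ⟨s, t, hst, h⟩
    exact Set.mem_iUnion.2 ⟨⟨(s, t), hst⟩, h⟩
  refine Set.Countable.mono h (Set.countable_iUnion fun p => ?_)
  obtain ⟨⟨s, t⟩, hst⟩ := p
  simp only at hst ⊢
  apply Set.Finite.countable
  apply Set.Finite.of_finite_image (f := fun (w : ℕ → Bool) (i : Fin t) => w i) (Set.toFinite _)
  intro w hw w' hw' heq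
  funext k
  induction k using Nat.strong_induction_on with
  | _ k ih =>
    by_cases hk : k < t
    · exact congrFun heq ⟨k, hk⟩
    · have h1 := congrFun hw (k - t)
      have h2 := congrFun hw' (k - t)
      simp only [sh] at h1 h2
      rw [show t + (k - t) = k by omega] at h1 h2
      rw [← h1, ← h2]
      exact ih _ (by omega)

lemma infinite_fiber {α : Type*} [Finite α] {T : Set ℕ} (hT : T.Infinite) (f : ℕ → α) :
    ∃ v, {n ∈ T | f n = v}.Infinite := by
  by_contra hc
  push Not at hc
  apply hT
  have h1 : T ⊆ ⋃ v, {n ∈ T | f n = v} := fun n hn => Set.mem_iUnion.2 ⟨f n, hn, rfl⟩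
  exact (Set.finite_iUnion fun v => by simpa using hc v).subset h1

lemma loops_horse {a b : ℝ} {w : ℕ → Bool} (hEP : ¬ EP w) {T : Set ℕ} (hT : T.Infinite)
    {K : Set (ℕ → Bool)} (hKne : K.Nonempty) (hKX : K ⊆ XX a b)
    (hK : ∀ s ∈ T, ∀ t ∈ T, s < t → ∀ z ∈ K, pre (t - s) (sh s w) z ∈ K) : Horse a b := by
  by_contra hH
  obtain ⟨s0, hs0⟩ := hT.nonempty
  obtain ⟨s1, hs1, h01⟩ := hT.exists_gt s0
  apply hEP
  refine ⟨s0, s1, h01, ?_⟩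
  funext k
  obtain ⟨t, ht, hst⟩ := hT.exists_gt (s1 + k)
  have hcomm : ∀ z, pre (s1 - s0) (sh s0 w) (pre (t - s0) (sh s0 w) z)
      = pre (t - s0) (sh s0 w) (pre (s1 - s0) (sh s0 w) z) := by
    by_contra hc
    push Not at hc
    exact hH ⟨_, _, _, _, hc, K, hKne, hKX, fun z hz =>
      ⟨hK s0 hs0 s1 hs1 h01 z hz, hK s0 hs0 t ht (by omega) z hz⟩⟩
  have h1 := congrFun (hcomm w) (s1 - s0 + k)
  have h2 : ¬ (s1 - s0 + k < s1 - s0) := by omega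
  have h3 : s1 - s0 + k < t - s0 := by omega
  have h4 : s1 - s0 + k - (s1 - s0) = k := by omega
  have h5 : k < t - s0 := by omega
  have h6 : s0 + (s1 - s0 + k) = s1 + k := by omega
  simp only [pre, h2, h3, h4, h5, if_true, if_false, sh, h6] at h1
  simpa [sh] using h1

def aL (a : ℝ) (v : ℕ → Bool) (m : ℕ) : Prop := lo v m ≤ a ∧ a < lo v m + 1 / 2 ^ m
def bL (b : ℝ) (v : ℕ → Bool) (m : ℕ) : Prop := lo v m < b ∧ b ≤ lo v m + 1 / 2 ^ m

lemma aL_mono {a : ℝ} {v : ℕ → Bool} {m n : ℕ} (h : m ≤ n) (hn : aL a v n) : aL a v m :=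
  ⟨(lo_mono v h).trans hn.1, lt_of_lt_of_le hn.2 (hi_anti v h)⟩

lemma bL_mono {a : ℝ} {v : ℕ → Bool} {m n : ℕ} (h : m ≤ n) (hn : bL a v n) : bL a v m :=
  ⟨lt_of_le_of_lt (lo_mono v h) hn.1, hn.2.trans (hi_anti v h)⟩

lemma nonlive {a b : ℝ} {v y : ℕ → Bool} {m : ℕ} (hv : piMap v ≤ a ∨ b ≤ piMap v)
    (ha : ¬ aL a v m) (hb : ¬ bL b v m) (h : ∀ k < m, y k = v k) :
    piMap y ≤ a ∨ b ≤ piMap y := by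
  have h1 := lo_congr h
  have h2 := lo_le v m
  have h3 := le_hi v m
  have h4 := lo_le y m
  have h5 := le_hi y m
  rw [h1] at h4 h5
  unfold aL at ha
  unfold bL at hb
  rcases hv with hv | hv
  · left
    by_contra hc
    exact ha ⟨by linarith, by linarith⟩
  · right
    by_contra hc
    exact hb ⟨by linarith, by linarith⟩

/-- there is a live suffix of length at least K at time n -/
def Long (a b : ℝ) (w : ℕ → Bool) (n K : ℕ) : Prop :=
  ∃ s, s + K ≤ n ∧ (aL a (sh s w) (n - s) ∨ bL b (sh s w) (n - s))

lemma recur_horse {a b : ℝ} {w : ℕ → Bool} (hw : w ∈ XX a b) (hEP : ¬ EP w) {K : ℕ}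
    (hinf : {n | ¬ Long a b w n K}.Infinite) : Horse a b := by
  have hinf' : {n | K ≤ n ∧ ¬ Long a b w n K}.Infinite := by
    have h1 : {n | ¬ Long a b w n K} \ Set.Iio K ⊆ {n | K ≤ n ∧ ¬ Long a b w n K} := by
      rintro n ⟨h1, h2⟩
      exact ⟨by simpa using h2, h1⟩
    exact (hinf.sdiff (Set.finite_Iio K)).mono h1
  obtain ⟨v0, hv0⟩ := infinite_fiber hinf' (fun n => fun i : Fin K => w (n - K + i))
  set T := {n | n ∈ {n | K ≤ n ∧ ¬ Long a b w n K} ∧ (fun i : Fin K => w (n - K + i)) = v0} with hTdef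
  obtain ⟨t0, ht0⟩ := hv0.nonempty
  set v := sh (t0 - K) w with hv
  have hTv : ∀ t ∈ T, ∀ i < K, v i = w (t - K + i) := by
    intro t ht i hi
    have h1 := congrFun (ht.2.trans ht0.2.symm) ⟨i, hi⟩
    simp only at h1
    rw [h1]; rfl
  refine loops_horse hEP hv0 (K := {z | pre K v z ∈ XX a b}) ⟨sh t0 w, ?_⟩ ?_ ?_
  · have h1 : pre K v (sh t0 w) = sh (t0 - K) w := by
      funext k
      have := ht0.1.1
      by_cases hk : k < K
      · simp [pre, hk, hv]
      · have : t0 + (k - K) = t0 - K + k := by omega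
        simp [pre, hk, sh, this]
    show pre K v (sh t0 w) ∈ XX a b
    rw [h1]; exact XX_sh hw _
  · intro z hz
    have := XX_sh hz K
    rwa [sh_pre_ge le_rfl, Nat.sub_self, sh_zero] at this
  · intro s hs t ht hst z hz
    have hsK := hs.1.1
    have htK := ht.1.1
    have hvs := hTv s hs
    have hvt := hTv t ht
    show pre K v (pre (t - s) (sh s w) z) ∈ XX a b
    have hy : pre K v (pre (t - s) (sh s w) z) = pre (t - s) (sh (s - K) w) (pre K v z) := by
      funext k
      simp only [pre, sh]
      by_cases h1 : k < K
      · by_cases h2 : k < t - s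
        · simp [h1, h2, hvs k h1]
        · have h3 : k - (t - s) < K := by omega
          simp only [h1, h2, h3, if_true, if_false, hvs k h1, hvt _ h3]
          congr 1; omega
      · by_cases h2 : k < t - s
        · have h3 : k - K < t - s := by omega
          simp only [h1, h2, h3, if_true, if_false]
          congr 1; omega
        · by_cases h3 : k - K < t - s
          · have h4 : k - (t - s) < K := by omega
            simp only [h1, h2, h3, h4, if_true, if_false, hvt _ h4]
            congr 1; omega
          · have h4 : ¬ k - (t - s) < K := by omega
            simp only [h1, h2, h3, h4, if_false]
            congr 1; omega
    rw [hy]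
    intro n
    by_cases hn : t - s ≤ n
    · rw [sh_pre_ge hn]
      exact hz _
    · have hlong := ht.1.2
      have hnl : ¬ (aL a (sh (s - K + n) w) (t - (s - K + n)) ∨
          bL b (sh (s - K + n) w) (t - (s - K + n))) := by
        intro hc
        exact hlong ⟨s - K + n, by omega, hc⟩
      push Not at hnl
      refine nonlive (hw (s - K + n)) hnl.1 hnl.2 ?_
      intro k hk
      simp only [sh, pre]
      by_cases h1 : n + k < t - s
      · simp only [h1, if_true]; congr 1; omega
      · have h2 : n + k - (t - s) < K := by omega
        simp only [h1, h2, if_true, if_false, hvt _ h2]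
        congr 1; omega

lemma branch {a b : ℝ} (ha : a < 1/2) (hb : 1/2 < b) {w w' : ℕ → Bool} (hw : w ∈ XX a b)
    (hw' : w' ∈ XX a b) {n : ℕ} (hag : ∀ k < n, w k = w' k) (h0 : w n = false) (h1 : w' n = true)
    {s : ℕ} (hs : s < n) {N : ℕ} (hN : n < N) :
    ¬ aL a (sh s w) (N - s) ∧ ¬ bL b (sh s w') (N - s) := by
  have hag' : ∀ k < n - s, sh s w k = sh s w' k := fun k hk => hag (s + k) (by omega)
  have hlo := lo_congr hag'
  have hsn : s + (n - s) = n := by omega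
  have e0 : sh s w (n - s) = false := by simp only [sh, hsn, h0]
  have e1 : sh s w' (n - s) = true := by simp only [sh, hsn, h1]
  have l0 := lo_succ (sh s w) (n - s)
  have l1 := lo_succ (sh s w') (n - s)
  rw [e0] at l0
  rw [e1] at l1
  simp only [dg, if_true, Bool.false_eq_true, if_false, zero_div, add_zero] at l0 l1
  have hws : w s = w' s := hag s hs
  constructor
  · intro hc
    have c1 := aL_mono (by omega : n - s + 1 ≤ N - s) hc
    have c2 := aL_mono (by omega : 1 ≤ N - s) hc
    have h3 : w s = false := by
      by_contra hcc
      have h4 : w s = true := by simpa using hcc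
      have := c2.1
      rw [show (1:ℕ) = 0 + 1 by rfl, lo_succ, lo_zero] at this
      simp [sh, dg, h4] at this
      linarith
    have h4 := XX_false hb hw' (hws ▸ h3)
    have h5 := lo_le (sh s w') (n - s + 1)
    have := c1.2
    linarith
  · intro hc
    have c1 := bL_mono (by omega : n - s + 1 ≤ N - s) hc
    have c2 := bL_mono (by omega : 1 ≤ N - s) hc
    have h3 : w' s = true := by
      by_contra hcc
      have h4 : w' s = false := by simpa using hcc
      have := c2.2
      rw [show (1:ℕ) = 0 + 1 by rfl, lo_succ, lo_zero] at this
      simp [sh, dg, h4] at this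
      linarith
    have h4 := XX_true ha hw (n := s) (hws ▸ h3)
    have h5 := le_hi (sh s w) (n - s + 1)
    have := c1.1
    linarith

def ZZ (a b : ℝ) (K n0 : ℕ) : Set (ℕ → Bool) := {w | w ∈ XX a b ∧ ∀ n ≥ n0, Long a b w n K}

/-- change of branching letter takes time -/
lemma change_aux {a b : ℝ} (ha : a < 1/2) (hb : 1/2 < b) {K n0 : ℕ} (hK : 2 ≤ K)
    {x y z : ℕ → Bool} (hx : x ∈ ZZ a b K n0) (hy : y ∈ ZZ a b K n0) (hz : z ∈ ZZ a b K n0)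
    {n n' : ℕ} (hn : n0 ≤ n) (hnn : n < n') (hxy : ∀ k < n, x k = y k) (hxy' : x n ≠ y n)
    (hyz : ∀ k < n', y k = z k) (hyz' : y n' ≠ z n') (hyy : y n ≠ y n') : n + K ≤ n' + 1 := by
  obtain ⟨s, hs1, hs2⟩ := hy.2 (n' + 1) (by omega)
  by_contra hc
  cases h0 : y n
  · have h1 : y n' = true := by rw [h0] at hyy; simpa using hyy.symm
    have h2 : x n = true := by rw [h0] at hxy'; simpa using hxy'
    have h3 : z n' = false := by rw [h1] at hyz'; simpa using hyz'.symm
    rcases hs2 with hs2 | hs2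
    · exact (branch ha hb hy.1 hx.1 (fun k hk => (hxy k hk).symm) h0 h2 (s := s) (by omega)
        (by omega : n < n' + 1)).1 hs2
    · exact (branch ha hb hz.1 hy.1 (fun k hk => (hyz k hk).symm) h3 h1 (s := s) (by omega)
        (by omega : n' < n' + 1)).2 hs2
  · have h1 : y n' = false := by rw [h0] at hyy; simpa using hyy.symm
    have h2 : x n = false := by rw [h0] at hxy'; simpa using hxy'
    have h3 : z n' = true := by rw [h1] at hyz'; simpa using hyz'.symm
    rcases hs2 with hs2 | hs2
    · exact (branch ha hb hy.1 hz.1 hyz h1 h3 (s := s) (by omega)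
        (by omega : n' < n' + 1)).1 hs2
    · exact (branch ha hb hx.1 hy.1 hxy h2 h0 (s := s) (by omega)
        (by omega : n < n' + 1)).2 hs2

lemma change {a b : ℝ} (ha : a < 1/2) (hb : 1/2 < b) {K n0 : ℕ} (hK : 2 ≤ K)
    {x y z : ℕ → Bool} (hx : x ∈ ZZ a b K n0) (hy : y ∈ ZZ a b K n0) (hz : z ∈ ZZ a b K n0)
    {n n' : ℕ} (hn : n0 ≤ n) (hnn : n < n') (hxy : ∀ k < n, x k = y k) (hxy' : x n ≠ y n)
    (hyz : ∀ k < n', y k = z k) (hyz' : y n' ≠ z n') : n + K ≤ n' + 1 := by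
  by_cases hyy : y n = y n'
  · refine change_aux ha hb hK hx hz hy hn hnn (fun k hk => ?_) ?_ (fun k hk => (hyz k hk).symm)
      hyz'.symm ?_
    · rw [hxy k hk, hyz k (by omega)]
    · rw [← hyz n hnn]; exact hxy'
    · rw [← hyz n hnn, hyy]; exact hyz'
  · exact change_aux ha hb hK hx hy hz hn hnn hxy hxy' hyz hyz' hyy

lemma first_diff_lt {x y : ℕ → Bool} {N : ℕ} (h : ¬ ∀ k < N, x k = y k) :
    ∃ p < N, (∀ k < p, x k = y k) ∧ x p ≠ y p := by
  push Not at h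
  obtain ⟨k, hk, hne⟩ := h
  obtain ⟨p, h1, h2⟩ := first_diff (w := x) (w' := y) (fun h => hne (by rw [h]))
  refine ⟨p, ?_, h1, h2⟩
  by_contra hc
  exact hne (h1 k (by omega))

lemma three {a b : ℝ} (ha : a < 1/2) (hb : 1/2 < b) {K n0 : ℕ} (hK : 2 ≤ K)
    {x y z : ℕ → Bool} (hx : x ∈ ZZ a b K n0) (hy : y ∈ ZZ a b K n0) (hz : z ∈ ZZ a b K n0)
    {n : ℕ} (hn : n0 ≤ n) (hxy : ∀ k < n, x k = y k) (hxz : ∀ k < n, x k = z k)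
    (h1 : ¬ ∀ k < n + (K - 1), x k = y k) (h2 : ¬ ∀ k < n + (K - 1), x k = z k)
    (h3 : ¬ ∀ k < n + (K - 1), y k = z k) : False := by
  obtain ⟨p, hp, p1, p2⟩ := first_diff_lt h1
  obtain ⟨q, hq, q1, q2⟩ := first_diff_lt h2
  obtain ⟨r, hr, r1, r2⟩ := first_diff_lt h3
  have hpn : n ≤ p := by by_contra hc; exact p2 (hxy p (by omega))
  have hqn : n ≤ q := by by_contra hc; exact q2 (hxz q (by omega))
  rcases lt_trichotomy p q with h | h | h
  · have := change ha hb hK hy hx hz (by omega) h (fun k hk => (p1 k hk).symm) p2.symm q1 q2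
    omega
  · subst h
    have h4 : y p = z p := by
      cases hh : x p <;> cases hh' : y p <;> cases hh'' : z p <;> simp_all
    have hpr : p < r := by
      by_contra hc
      rcases Nat.lt_or_eq_of_le (not_lt.1 hc) with h | h
      · exact r2 (by rw [← p1 r h, ← q1 r h])
      · subst h; exact r2 h4
    have := change ha hb hK hx hy hz (by omega) hpr p1 p2 r1 r2
    omega
  · have := change ha hb hK hz hx hy (by omega) h (fun k hk => (q1 k hk).symm) q2.symm p1 p2
    omega

/-- prefixes of length n -/
def PP (Z : Set (ℕ → Bool)) (n : ℕ) : Finset (Fin n → Bool) :=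
  (Set.toFinite ((fun (w : ℕ → Bool) (i : Fin n) => w i) '' Z)).toFinset

lemma PP_card_step {a b : ℝ} (ha : a < 1/2) (hb : 1/2 < b) {K n0 : ℕ} (hK : 2 ≤ K)
    {n : ℕ} (hn : n0 ≤ n) :
    (PP (ZZ a b K n0) (n + (K - 1))).card ≤ 2 * (PP (ZZ a b K n0) n).card := by
  classical
  refine Finset.card_le_mul_card_image_of_maps_to
    (f := fun (v : Fin (n + (K - 1)) → Bool) (i : Fin n) => v ⟨i, by omega⟩) ?_ 2 ?_
  · intro v hv
    simp only [PP, Set.Finite.mem_toFinset, Set.mem_image] at hv ⊢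
    obtain ⟨w, hw, rfl⟩ := hv
    exact ⟨w, hw, rfl⟩
  · intro v hv
    by_contra hc
    push Not at hc
    obtain ⟨x, y, z, hx, hy, hz, h1, h2, h3⟩ := Finset.two_lt_card_iff.1 hc
    simp only [PP, Set.Finite.mem_toFinset, Set.mem_image, Finset.mem_filter] at hx hy hz
    obtain ⟨⟨x, hx, rfl⟩, hxv⟩ := hx
    obtain ⟨⟨y, hy, rfl⟩, hyv⟩ := hy
    obtain ⟨⟨z, hz, rfl⟩, hzv⟩ := hz
    refine three ha hb hK hx hy hz hn (fun k hk => ?_) (fun k hk => ?_)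
      (fun h => h1 ?_) (fun h => h2 ?_) (fun h => h3 ?_)
    · exact congrFun (hxv.trans hyv.symm) ⟨k, hk⟩
    · exact congrFun (hxv.trans hzv.symm) ⟨k, hk⟩
    · funext i; exact h i i.2
    · funext i; exact h i i.2
    · funext i; exact h i i.2

lemma PP_card {a b : ℝ} (ha : a < 1/2) (hb : 1/2 < b) {K n0 : ℕ} (hK : 2 ≤ K) (j : ℕ) :
    (PP (ZZ a b K n0) (n0 + j * (K - 1))).card ≤ 2 ^ (n0 + j) := by
  induction j with
  | zero =>
    have := Finset.card_le_univ (PP (ZZ a b K n0) (n0 + 0 * (K - 1)))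
    simpa using this
  | succ j ih =>
    have h1 := PP_card_step ha hb hK (n0 := n0) (n := n0 + j * (K - 1)) (by omega)
    have h2 : n0 + (j + 1) * (K - 1) = n0 + j * (K - 1) + (K - 1) := by ring
    rw [h2]
    calc _ ≤ _ := h1
      _ ≤ 2 * 2 ^ (n0 + j) := by omega
      _ = _ := by ring

end DM


namespace DM
open MeasureTheory Filter Topology

lemma ZZ_dim {a b : ℝ} (ha : a < 1/2) (hb : 1/2 < b) (L n0 : ℕ) (hL : 1 ≤ L) :
    dimH (piMap '' ZZ a b (L+1) n0) ≤ ((L : ENNReal))⁻¹ := by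
  have hd : ((L : ENNReal))⁻¹ = (((L : NNReal)⁻¹ : NNReal) : ENNReal) := by
    rw [ENNReal.coe_inv (by positivity)]; simp
  rw [hd]
  apply dimH_le_of_hausdorffMeasure_ne_top
  set Z := ZZ a b (L+1) n0 with hZ
  have key := Measure.hausdorffMeasure_le_liminf_sum (X := ℝ)
    (ι := fun j : ℕ => ↥(PP Z (n0 + j * L))) (((L : NNReal)⁻¹ : NNReal) : ℝ)
    (piMap '' Z) (l := atTop) (fun j : ℕ => (2⁻¹ : ENNReal) ^ (j * L))
    (by
      have h1 : Tendsto (fun n : ℕ => (2⁻¹ : ENNReal) ^ n) atTop (𝓝 0) :=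
        ENNReal.tendsto_pow_atTop_nhds_zero_of_lt_one (by simp)
      refine h1.comp (tendsto_atTop_mono (f := fun j : ℕ => j) (fun j => ?_) tendsto_id)
      exact Nat.le_mul_of_pos_right j hL)
    (fun j v => piMap '' {w | w ∈ Z ∧ (fun i : Fin (n0 + j * L) => w i) = v.1})
  have hdiam : ∀ (j : ℕ) (v : ↥(PP Z (n0 + j * L))),
      Metric.ediam (piMap '' {w | w ∈ Z ∧ (fun i : Fin (n0 + j * L) => w i) = v.1})
        ≤ (2⁻¹ : ENNReal) ^ (j * L) := by
    intro j v
    refine Metric.ediam_le ?_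
    rintro _ ⟨x, ⟨-, hx⟩, rfl⟩ _ ⟨y, ⟨-, hy⟩, rfl⟩
    have h1 : ∀ k < j * L, x k = y k := by
      intro k hk
      exact congrFun (hx.trans hy.symm) ⟨k, by omega⟩
    have h2 := pi_close h1
    rw [edist_dist, Real.dist_eq]
    refine (ENNReal.ofReal_le_ofReal h2).trans (le_of_eq ?_)
    rw [one_div, ENNReal.ofReal_inv_of_pos (by positivity), ENNReal.ofReal_pow (by norm_num),
      ENNReal.inv_pow]
    norm_num
  have key2 := key (Eventually.of_forall hdiam) (Eventually.of_forall (fun j => by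
    rintro _ ⟨w, hw, rfl⟩
    refine Set.mem_iUnion.2 ⟨⟨fun i => w i, ?_⟩, w, ⟨hw, rfl⟩, rfl⟩
    simp only [PP, Set.Finite.mem_toFinset, Set.mem_image]
    exact ⟨w, hw, rfl⟩))
  have hb2 : ∀ j : ℕ, ∑ v : ↥(PP Z (n0 + j * L)),
      Metric.ediam (piMap '' {w | w ∈ Z ∧ (fun i : Fin (n0 + j * L) => w i) = v.1})
        ^ (((L : NNReal)⁻¹ : NNReal) : ℝ) ≤ (2 : ENNReal) ^ n0 := by
    intro j
    have hterm : ∀ v : ↥(PP Z (n0 + j * L)),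
      Metric.ediam (piMap '' {w | w ∈ Z ∧ (fun i : Fin (n0 + j * L) => w i) = v.1})
        ^ (((L : NNReal)⁻¹ : NNReal) : ℝ) ≤ (2⁻¹ : ENNReal) ^ j := by
      intro v
      refine (ENNReal.rpow_le_rpow (hdiam j v) (by positivity)).trans (le_of_eq ?_)
      rw [pow_mul, ← ENNReal.rpow_natCast _ L, ← ENNReal.rpow_mul]
      have : (L : ℝ) ≠ 0 := by positivity
      simp [this]
    refine (Finset.sum_le_sum fun v _ => hterm v).trans ?_
    rw [Finset.sum_const, nsmul_eq_mul, Finset.card_univ, Fintype.card_coe]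
    have hc : (PP Z (n0 + j * L)).card ≤ 2 ^ (n0 + j) :=
      PP_card ha hb (K := L + 1) (n0 := n0) (by omega) j
    have hc' : ((PP Z (n0 + j * L)).card : ENNReal) ≤ 2 ^ (n0 + j) := by exact_mod_cast hc
    refine (mul_le_mul_left hc' _).trans (le_of_eq ?_)
    rw [pow_add, mul_assoc, ← mul_pow, ENNReal.mul_inv_cancel (by norm_num) (by norm_num)]
    simp
  have h3 : μH[(((L : NNReal)⁻¹ : NNReal) : ℝ)] (piMap '' Z) ≤ (2 : ENNReal) ^ n0 := by
    refine key2.trans ?_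
    refine (liminf_le_liminf (Eventually.of_forall hb2)).trans ?_
    simp
  exact ne_top_of_le_ne_top (by finiteness) h3

lemma nohorse_dim {a b : ℝ} (ha : a < 1/2) (hb : 1/2 < b) (h : ¬ Horse a b) :
    dimH (J a b) = 0 := by
  have key : ∀ L : ℕ, 1 ≤ L → dimH (J a b) ≤ ((L : ENNReal))⁻¹ := by
    intro L hL
    have hsub : J a b ⊆ piMap '' {w | EP w} ∪ ⋃ n0 : ℕ, piMap '' ZZ a b (L+1) n0 := by
      rw [J_eq ha hb]
      rintro _ ⟨w, hw, rfl⟩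
      by_cases hEP : EP w
      · exact Or.inl ⟨w, hEP, rfl⟩
      · right
        have hfin : {n | ¬ Long a b w n (L+1)}.Finite := by
          by_contra hc
          exact h (recur_horse hw hEP hc)
        obtain ⟨n0, hn0⟩ := hfin.bddAbove
        refine Set.mem_iUnion.2 ⟨n0 + 1, w, ⟨hw, ?_⟩, rfl⟩
        intro n hn
        by_contra hc
        have := hn0 hc
        omega
    refine (dimH_mono hsub).trans ?_
    rw [dimH_union, dimH_countable (EP_countable.image _), dimH_iUnion]
    refine max_le (by simp) (iSup_le fun n0 => ZZ_dim ha hb L n0 hL)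
  refine le_antisymm ?_ bot_le
  refine ge_of_tendsto ENNReal.tendsto_inv_nat_nhds_zero ?_
  filter_upwards [eventually_ge_atTop 1] with L hL using key L hL

end DM

namespace DM
open Filter Topology

lemma window {a b b' : ℝ} {v y : ℕ → Bool} {N : ℕ} (hN : (1:ℝ) / 2 ^ N ≤ b' - b)
    (hv : piMap v ≤ a ∨ b' ≤ piMap v) (hy : ∀ k < N, y k = v k) (hL : ¬ aL a v N) :
    piMap y ≤ a ∨ b ≤ piMap y := by
  have e := lo_congr hy
  have h1 := le_hi y N
  have h2 := lo_le y N
  have h3 := le_hi v N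
  have h4 := lo_le v N
  unfold aL at hL
  by_cases h : lo v N ≤ a
  · left
    have : ¬ (a < lo v N + 1 / 2 ^ N) := fun h' => hL ⟨h, h'⟩
    linarith
  · right
    rcases hv with hv | hv <;> linarith

lemma aL_le {a b b' : ℝ} (hab : a < b) {v : ℕ → Bool} {N : ℕ} (hN : (1:ℝ) / 2 ^ N ≤ b' - b)
    (hv : piMap v ≤ a ∨ b' ≤ piMap v) (hL : aL a v N) : piMap v ≤ a := by
  rcases hv with hv | hv
  · exact hv
  · have h3 := le_hi v N
    have := hL.1
    linarith

lemma aL_unique_aux {a : ℝ} {v v' : ℕ → Bool} {N n : ℕ} (hn : n < N) (h : aL a v N)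
    (h' : aL a v' N) (he : ∀ k < n, v k = v' k) (h1 : v n = false) (h2 : v' n = true) : False := by
  have e := lo_congr he
  have g := (aL_mono (show n + 1 ≤ N from hn) h).2
  have g' := (aL_mono (show n + 1 ≤ N from hn) h').1
  rw [lo_succ, h1] at g
  rw [lo_succ, h2] at g'
  simp only [dg] at g g'
  norm_num at g g'
  linarith

lemma aL_unique {a : ℝ} {v v' : ℕ → Bool} {N : ℕ} (h : aL a v N) (h' : aL a v' N) :
    ∀ k < N, v k = v' k := by
  by_contra hc
  obtain ⟨n, hn, he, hd⟩ := first_diff_lt hc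
  cases h1 : v n
  · have h2 : v' n = true := by rw [h1] at hd; simpa using hd.symm
    exact aL_unique_aux hn h h' he h1 h2
  · have h2 : v' n = false := by rw [h1] at hd; simpa using hd.symm
    exact aL_unique_aux hn h' h (fun k hk => (he k hk).symm) h2 h1

lemma glue {a b b' : ℝ} {w z : ℕ → Bool} {N s t : ℕ} (hst : s < t)
    (hN : (1:ℝ) / 2 ^ N ≤ b' - b) (hw : w ∈ XX a b') (hz : z ∈ XX a b)
    (hzw : ∀ k < N, z k = w (t + k)) (hmid : ∀ m, s < m → m < t → ¬ aL a (sh m w) N)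
    (hs : ¬ aL a (sh s w) N ∨ piMap (pre (t - s) (sh s w) z) ≤ a) :
    pre (t - s) (sh s w) z ∈ XX a b ∧ ∀ k < N, pre (t - s) (sh s w) z k = w (s + k) := by
  set y := pre (t - s) (sh s w) z with hy
  have hag : ∀ k < t - s + N, y k = w (s + k) := by
    intro k hk
    by_cases h : k < t - s
    · simp [hy, pre, h, sh]
    · have h1 := hzw (k - (t - s)) (by omega)
      have h2 : t + (k - (t - s)) = s + k := by omega
      simp only [hy, pre, h, if_false]
      rw [h1, h2]
  refine ⟨?_, fun k hk => hag k (by omega)⟩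
  intro n
  by_cases hn : n < t - s
  · have hwin : ¬ aL a (sh (s + n) w) N → piMap (sh n y) ≤ a ∨ b ≤ piMap (sh n y) := by
      intro hL
      refine window hN (hw (s + n)) ?_ hL
      intro k hk
      have := hag (n + k) (by omega)
      simp only [sh]
      rw [this]; congr 1; omega
    by_cases h0 : n = 0
    · subst h0
      rcases hs with hs | hs
      · exact hwin hs
      · left; rwa [sh_zero]
    · exact hwin (hmid _ (by omega) (by omega))
  · rw [hy, sh_pre_ge (by omega)]
    exact hz _

lemma doubling {g : ℕ → ℝ} (h : ∀ i, 2 * |g i| ≤ |g (i+1)|) {B : ℝ} (hb : ∀ i, |g i| ≤ B) (i : ℕ) :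
    g i = 0 := by
  by_contra hc
  have h0 : 0 < |g i| := abs_pos.2 hc
  have hp : ∀ n, 2 ^ n * |g i| ≤ |g (i + n)| := by
    intro n
    induction n with
    | zero => simp
    | succ n ih =>
      have := h (i + n)
      calc 2 ^ (n+1) * |g i| = 2 * (2 ^ n * |g i|) := by ring
        _ ≤ _ := by rw [← add_assoc]; linarith
  obtain ⟨n, hn⟩ := pow_unbounded_of_one_lt (B / |g i|) (by norm_num : (1:ℝ) < 2)
  rw [div_lt_iff₀ h0] at hn
  linarith [hp n, hb (i + n)]

lemma real_gap {g p : ℕ → ℝ} (hp : ∀ i, 0 < p i) (hp2 : ∀ i, p i ≤ 1/2)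
    (h : ∀ i, p i * g (i+1) = g i ∨ (0 ≤ p i * g (i+1) ∧ g i ≤ p i * g (i+1)))
    {B : ℝ} (hb : ∀ i, |g i| ≤ B) : ∃ i, g i = g (i+1) := by
  by_cases hc : ∃ i0, 0 ≤ g i0
  · obtain ⟨i0, hi0⟩ := hc
    have hstep : ∀ i, 0 ≤ g i → 0 ≤ g (i+1) ∧ 2 * g i ≤ g (i+1) := by
      intro i hi
      have h1 : 0 ≤ p i * g (i+1) ∧ g i ≤ p i * g (i+1) := by
        rcases h i with h | h
        · rw [h]; exact ⟨hi, le_rfl⟩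
        · exact h
      have h2 : 0 ≤ g (i+1) := nonneg_of_mul_nonneg_right h1.1 (hp i)
      refine ⟨h2, ?_⟩
      nlinarith [hp2 i]
    have hnn : ∀ n, 0 ≤ g (i0 + n) := by
      intro n
      induction n with
      | zero => simpa
      | succ n ih => exact (hstep _ ih).1
    have := doubling (g := fun n => g (i0 + n)) (fun n => by
      rw [abs_of_nonneg (hnn n), abs_of_nonneg (hnn (n+1))]
      exact (hstep _ (hnn n)).2) (fun n => hb _)
    exact ⟨i0, (this 0).trans (this 1).symm⟩
  · push Not at hc
    have := doubling (g := g) (fun n => by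
      rcases h n with h | h
      · have h1 : |g n| = p n * |g (n+1)| := by rw [← h, abs_mul, abs_of_pos (hp n)]
        rw [h1]
        nlinarith [hp2 n, abs_nonneg (g (n+1))]
      · have := nonneg_of_mul_nonneg_right h.1 (hp n)
        linarith [hc (n+1)]) hb
    exact ⟨0, (this 0).trans (this 1).symm⟩

lemma pre_comp (m m' : ℕ) (u u' : ℕ → Bool) :
    ∃ U, ∀ z, pre m u (pre m' u' z) = pre (m + m') U z :=
  ⟨_, fun z => pre_pre m m' u u' z (fun _ => false)⟩

lemma pre_iter (m : ℕ) (u : ℕ → Bool) (n : ℕ) : ∃ M U, ∀ z, (pre m u)^[n] z = pre M U z := by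
  induction n with
  | zero => exact ⟨0, u, fun z => by funext k; simp [pre]⟩
  | succ n ih =>
    obtain ⟨M, U, h⟩ := ih
    obtain ⟨V, hV⟩ := pre_comp m M u U
    exact ⟨m + M, V, fun z => by rw [Function.iterate_succ_apply', h, hV]⟩

lemma pre_one {m : ℕ} {u u' y : ℕ → Bool} (h : pre m u y = pre m u' y) (z : ℕ → Bool) :
    pre m u z = pre m u' z := by
  funext k
  have := congrFun h k
  by_cases hk : k < m
  · simpa [pre, hk] using this
  · simp [pre, hk]

lemma comm_one {m m' : ℕ} {u u' y : ℕ → Bool}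
    (h : pre m u (pre m' u' y) = pre m' u' (pre m u y)) (z : ℕ → Bool) :
    pre m u (pre m' u' z) = pre m' u' (pre m u z) := by
  obtain ⟨U, hU⟩ := pre_comp m m' u u'
  obtain ⟨V, hV⟩ := pre_comp m' m u' u
  rw [hU, hV, add_comm m' m] at h ⊢
  exact pre_one h z

/-- a good block `C` and another block `A` : either they commute or `F_A(c) ≥ a`, or a horse -/
lemma dichotomy {a b : ℝ} (hH : ¬ Horse a b) {K : Set (ℕ → Bool)} (hKne : K.Nonempty)
    (hKX : K ⊆ XX a b) (hKa : ∀ z ∈ K, piMap z ≤ a) {m m' : ℕ} {u u' : ℕ → Bool} (hm : 1 ≤ m)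
    (hC : ∀ z ∈ K, pre m u z ∈ K)
    (hA : ∀ z ∈ K, piMap (pre m' u' z) ≤ a → pre m' u' z ∈ K)
    {c : ℝ} (hc : c = lo u m + c / 2 ^ m) :
    lo u' m' + c / 2 ^ m' = c ∨ a ≤ lo u' m' + c / 2 ^ m' := by
  have hq : (0:ℝ) < 1 / 2 ^ m := by positivity
  have hq1 : (1:ℝ) / 2 ^ m < 1 := by
    rw [div_lt_one (by positivity)]
    exact one_lt_pow₀ (by norm_num) (by omega)
  by_cases hcomm : ∀ z, pre m' u' (pre m u z) = pre m u (pre m' u' z)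
  · left
    have h1 := congrArg piMap (hcomm (fun _ => false))
    simp only [pi_pre] at h1
    have h2 : lo u' m' * (1 - 1 / 2 ^ m) = lo u m * (1 - 1 / 2 ^ m') := by
      linear_combination h1
    have h3 : lo u m = c * (1 - 1 / 2 ^ m) := by linear_combination -hc
    rw [h3] at h2
    have h4 : lo u' m' = c * (1 - 1 / 2 ^ m') := by
      apply mul_right_cancel₀ (show (1 - (1:ℝ) / 2 ^ m) ≠ 0 by linarith)
      linear_combination h2
    rw [h4]; ring
  · right
    have hn : ∀ n : ℕ, a < lo u' m' + (c + (a - c) * (1 / 2 ^ m) ^ n) / 2 ^ m' := by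
      intro n
      by_contra hle
      push Not at hle
      apply hH
      obtain ⟨M0, U0, h0⟩ := pre_iter m u n
      obtain ⟨U, hU⟩ := pre_comp m' M0 u' U0
      have hmap : ∀ z, pre (m' + M0) U z = pre m' u' ((pre m u)^[n] z) := fun z => by
        rw [h0, hU]
      refine ⟨m, u, m' + M0, U, ?_, K, hKne, hKX, ?_⟩
      · by_contra hall
        push Not at hall
        apply hcomm
        have h1 := hall (fun _ => false)
        rw [hmap, hmap, ← Function.iterate_succ_apply, Function.iterate_succ_apply'] at h1
        exact comm_one h1.symm
      · intro z hz
        refine ⟨hC z hz, ?_⟩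
        rw [hmap]
        have hit : ∀ n : ℕ, (pre m u)^[n] z ∈ K ∧
            piMap ((pre m u)^[n] z) ≤ c + (a - c) * (1 / 2 ^ m) ^ n := by
          intro n
          induction n with
          | zero => simpa using ⟨hz, hKa z hz⟩
          | succ n ih =>
            rw [Function.iterate_succ_apply']
            refine ⟨hC _ ih.1, ?_⟩
            rw [pi_pre]
            have h1 := mul_le_mul_of_nonneg_left ih.2 hq.le
            have h2 : piMap ((pre m u)^[n] z) / 2 ^ m = 1 / 2 ^ m * piMap ((pre m u)^[n] z) := by ring
            have h3 : c / 2 ^ m = 1 / 2 ^ m * c := by ring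
            rw [h2]
            rw [h3] at hc
            rw [pow_succ]
            nlinarith
        apply hA _ (hit n).1
        rw [pi_pre]
        refine le_trans ?_ hle
        have := (hit n).2
        gcongr
    have hlim : Tendsto (fun n : ℕ => lo u' m' + (c + (a - c) * (1 / 2 ^ m) ^ n) / 2 ^ m') atTop
        (𝓝 (lo u' m' + (c + (a - c) * 0) / 2 ^ m')) := by
      have := tendsto_pow_atTop_nhds_zero_of_lt_one hq.le hq1
      exact (((this.const_mul (a - c)).const_add c).div_const _).const_add _
    have := ge_of_tendsto' hlim (fun n => (hn n).le)
    simpa using this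

lemma L3 {a b b' : ℝ} (ha : a < 1/2) (hb : 1/2 < b) (hbb : b < b') {w : ℕ → Bool}
    (hw : w ∈ XX a b') (hEP : ¬ EP w) : Horse a b := by
  obtain ⟨N, hN⟩ : ∃ N : ℕ, (1:ℝ) / 2 ^ N ≤ b' - b := by
    obtain ⟨N, hN⟩ := exists_pow_lt_of_lt_one (show 0 < b' - b by linarith)
      (show (1/2 : ℝ) < 1 by norm_num)
    exact ⟨N, by rw [one_div_pow] at hN; exact hN.le⟩
  have hwb : w ∈ XX a b := XX_mono hbb.le hw
  by_cases hS : {m | aL a (sh m w) N}.Infinite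
  · by_contra hH
    set t : ℕ → ℕ := Nat.nth (fun m => aL a (sh m w) N) with ht
    have htm : StrictMono t := Nat.nth_strictMono hS
    have htS : ∀ i, aL a (sh (t i) w) N := fun i => Nat.nth_mem_of_infinite hS i
    have hmid : ∀ i m, t i < m → m < t (i+1) → ¬ aL a (sh m w) N := by
      classical
      intro i m h1 h2 hm
      have h3 : t (Nat.count (fun m => aL a (sh m w) N) m) = m :=
        Nat.nth_count (p := fun m => aL a (sh m w) N) hm
      rw [← h3] at h1 h2
      have := htm.lt_iff_lt.1 h1
      have := htm.lt_iff_lt.1 h2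
      omega
    have hlt : ∀ i, t i < t (i+1) := fun i => htm (Nat.lt_succ_self i)
    have hxa : ∀ i, piMap (sh (t i) w) ≤ a := fun i =>
      aL_le (by linarith) hN (hw (t i)) (htS i)
    set K : Set (ℕ → Bool) := {z | z ∈ XX a b ∧ (∀ k < N, z k = sh (t 0) w k) ∧ piMap z ≤ a} with hK
    have hKne : K.Nonempty := ⟨sh (t 0) w, XX_sh hwb _, fun _ _ => rfl, hxa 0⟩
    have hKX : K ⊆ XX a b := fun z hz => hz.1
    have hKa : ∀ z ∈ K, piMap z ≤ a := fun z hz => hz.2.2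
    have hstep : ∀ i, ∀ z ∈ K, piMap (pre (t (i+1) - t i) (sh (t i) w) z) ≤ a →
        pre (t (i+1) - t i) (sh (t i) w) z ∈ K := by
      intro i z hz hle
      have := glue (hlt i) hN hw hz.1
        (fun k hk => (hz.2.1 k hk).trans (aL_unique (htS 0) (htS (i+1)) k hk)) (hmid i) (Or.inr hle)
      exact ⟨this.1, fun k hk => (this.2 k hk).trans (aL_unique (htS i) (htS 0) k hk), hle⟩
    set l : ℕ → ℝ := fun i => lo (sh (t i) w) (t (i+1) - t i) with hl
    set p : ℕ → ℝ := fun i => 1 / 2 ^ (t (i+1) - t i) with hpdef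
    set x : ℕ → ℝ := fun i => piMap (sh (t i) w) with hx
    have hp : ∀ i, 0 < p i := fun i => by simp only [hpdef]; positivity
    have hp2 : ∀ i, p i ≤ 1/2 := by
      intro i
      simp only [hpdef]
      have h1 := hlt i
      have : (2:ℝ) ^ 1 ≤ 2 ^ (t (i+1) - t i) := pow_le_pow_right₀ (by norm_num) (by omega)
      apply one_div_le_one_div_of_le (by norm_num)
      simpa using this
    have hxr : ∀ i, x i = l i + p i * x (i+1) := by
      intro i
      simp only [hx, hl, hpdef, lo]
      rw [sh_sh, Nat.add_sub_cancel' (hlt i).le]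
      ring
    have hx0 : ∀ i, 0 ≤ x i := fun i => pi_nonneg _
    have hxne : ∀ i, x i ≠ x (i+1) := by
      intro i hi
      exact hEP ⟨t i, t (i+1), hlt i, pi_inj ha hb (XX_sh hwb _) (XX_sh hwb _) hi⟩
    have hl0 : ∀ i, 0 ≤ l i := fun i => by
      have := lo_mono (sh (t i) w) (Nat.zero_le (t (i+1) - t i))
      rwa [lo_zero] at this
    -- a good block exists
    have hgood : ∃ i, l i + p i * a ≤ a := by
      by_contra hc
      push Not at hc
      obtain ⟨i, hi⟩ := real_gap (g := fun i => a - x i) hp hp2 (fun i => Or.inr (by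
        have h1 := hc i
        have h2 := hxr i
        have h3 : x i ≤ a := hxa i
        have h4 : p i * (a - x (i+1)) = p i * a - p i * x (i+1) := by ring
        constructor <;> linarith)) (B := 1) (fun i => by
          have h3 : x i ≤ a := hxa i
          rw [abs_le]
          constructor <;> linarith [hx0 i])
      exact hxne i (by linarith)
    obtain ⟨i0, hi0⟩ := hgood
    set c : ℝ := l i0 / (1 - p i0) with hcdef
    have h1p : 0 < 1 - p i0 := by linarith [hp2 i0]
    have hcl : c * (1 - p i0) = l i0 := by rw [hcdef]; field_simp
    have hc0 : 0 ≤ c := div_nonneg (hl0 i0) h1p.le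
    have hca : c ≤ a := by
      rw [hcdef, div_le_iff₀ h1p]; linarith
    have hdich : ∀ i, l i + c / 2 ^ (t (i+1) - t i) = c ∨ a ≤ l i + c / 2 ^ (t (i+1) - t i) := by
      intro i
      refine dichotomy hH hKne hKX hKa (m := t (i0+1) - t i0) (u := sh (t i0) w)
        (by have := hlt i0; omega) ?_ (hstep i) ?_
      · intro z hz
        apply hstep i0 z hz
        rw [pi_pre]
        have h1 := mul_le_mul_of_nonneg_left (hKa z hz) (hp i0).le
        have h2 : piMap z / 2 ^ (t (i0+1) - t i0) = p i0 * piMap z := by simp only [hpdef]; ring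
        rw [h2]
        exact (add_le_add_right h1 (l i0)).trans hi0
      · have h2 : c / 2 ^ (t (i0+1) - t i0) = p i0 * c := by simp only [hpdef]; ring
        rw [h2]
        show c = l i0 + p i0 * c
        linarith
    obtain ⟨i, hi⟩ := real_gap (g := fun i => c - x i) hp hp2 (fun i => by
        have h2 : c / 2 ^ (t (i+1) - t i) = p i * c := by simp only [hpdef]; ring
        have h3 : x i ≤ a := hxa i
        have h4 : p i * (c - x (i+1)) = p i * c - p i * x (i+1) := by ring
        have h5 := hxr i
        have h6 := hdich i
        rw [h2] at h6
        rcases h6 with h6 | h6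
        · left
          linarith
        · right
          constructor <;> linarith) (B := 1) (fun i => by
          have h3 : x i ≤ a := hxa i
          rw [abs_le]
          constructor <;> linarith [hx0 i])
    exact hxne i (by linarith)
  · rw [Set.not_infinite] at hS
    obtain ⟨n0, hn0⟩ := hS.bddAbove
    have hno : ∀ m, n0 < m → ¬ aL a (sh m w) N := by
      intro m hm hL
      have := hn0 hL
      omega
    obtain ⟨v, hv⟩ := infinite_fiber (Set.Ioi_infinite n0) (fun n => fun i : Fin N => w (n + i))
    have hvw : ∀ n ∈ {n ∈ Set.Ioi n0 | (fun i : Fin N => w (n + i)) = v},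
        ∀ k (hk : k < N), w (n + k) = v ⟨k, hk⟩ := fun n hn k hk => congrFun hn.2 ⟨k, hk⟩
    obtain ⟨t0, ht0⟩ := hv.nonempty
    refine loops_horse hEP hv (K := {z | z ∈ XX a b ∧ ∀ k (hk : k < N), z k = v ⟨k, hk⟩})
      ⟨sh t0 w, XX_sh hwb _, hvw t0 ht0⟩ (fun z hz => hz.1) ?_
    intro s hs t ht hst z hz
    have := glue hst hN hw hz.1 (fun k hk => (hz.2 k hk).trans (hvw t ht k hk).symm)
      (fun m h1 _ => hno m (by have : n0 < s := hs.1; omega)) (Or.inl (hno s hs.1))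
    exact ⟨this.1, fun k hk => (this.2 k hk).trans (hvw s hs k hk)⟩

end DM

theorem stmt3 (a b : ℝ) (ha : a ∈ Set.Ioo (0:ℝ) (1/2)) (hb : b ∈ Set.Ioo (1/2:ℝ) 1) :
    0 < dimH (J a b) ↔ b < chi a  := by
  obtain ⟨ha0, ha⟩ := ha
  obtain ⟨hb, hb1⟩ := hb
  constructor
  · intro hd
    have hH : DM.Horse a b := by
      by_contra hc
      rw [DM.nohorse_dim ha hb hc] at hd
      exact lt_irrefl _ hd
    obtain ⟨b', h1, h2, h3⟩ := DM.horse_uncount ha hb hb1 hH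
    refine lt_of_lt_of_le h1 (le_csSup ⟨1, fun y hy => hy.1.2.le⟩ ⟨⟨by linarith, h2⟩, h3⟩)
  · intro h
    have hne : {b | b ∈ Set.Ioo a 1 ∧ ¬ (J a b).Countable}.Nonempty := by
      by_contra hc
      rw [Set.not_nonempty_iff_eq_empty] at hc
      unfold chi at h
      rw [hc, Real.sSup_empty] at h
      linarith
    obtain ⟨b', ⟨hb', hunc⟩, hbb⟩ := exists_lt_of_lt_csSup hne h
    rw [DM.J_eq ha (by linarith)] at hunc
    have : ∃ w ∈ DM.XX a b', ¬ DM.EP w := by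
      by_contra hc
      push Not at hc
      exact hunc ((DM.EP_countable.mono hc).image _)
    obtain ⟨w, hw, hEP⟩ := this
    exact DM.horse_dim ha hb (DM.L3 ha hb hbb hw hEP)

end
end

section
/- For every (a,b) with a ∈ (1/4,1/2) and b ∈ (1/2,3/4): 𝒥(a,b) ≠ {0,1} if and only if b ≤ φ(a); in particular, the set 𝒥(a,φ(a)) is infinite. -/
noncomputable section

lemma J_anti {a b b' : ℝ} (h : b ≤ b') : J a b' ⊆ J a b := fun _ hx =>
  ⟨hx.1, fun n hn => hx.2 n ⟨hn.1, lt_of_lt_of_le hn.2 h⟩⟩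

lemma Dbl_mem {x : ℝ} (hx : x ∈ Set.Icc (0:ℝ) 1) : Dbl x ∈ Set.Icc (0:ℝ) 1 := by
  obtain ⟨h0, h1⟩ := hx
  unfold Dbl
  split_ifs with h
  · constructor <;> linarith
  · constructor <;> linarith

lemma J_iff {a b x : ℝ} (hx : x ∈ Set.Icc (0:ℝ) 1) :
    x ∈ J a b ↔ x ∉ Set.Ioo a b ∧ Dbl x ∈ J a b := by
  constructor
  · intro h
    refine ⟨h.2 0, Dbl_mem hx, fun n => ?_⟩
    have := h.2 (n+1)
    rwa [Function.iterate_succ_apply] at this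
  · rintro ⟨h0, h1⟩
    refine ⟨hx, fun n => ?_⟩
    cases n with
    | zero => exact h0
    | succ n => rw [Function.iterate_succ_apply]; exact h1.2 n

lemma zero_mem_J {a b : ℝ} (ha : 0 < a) : (0:ℝ) ∈ J a b := by
  refine ⟨by simp, fun n => ?_⟩
  have : Dbl^[n] 0 = 0 := Function.iterate_fixed (by simp [Dbl]) n
  rw [this]
  exact fun h => by linarith [h.1]

lemma one_mem_J {a b : ℝ} (hb : b ≤ 1) : (1:ℝ) ∈ J a b := by
  refine ⟨by simp, fun n => ?_⟩
  have : Dbl^[n] 1 = 1 := Function.iterate_fixed (by norm_num [Dbl]) n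
  rw [this]
  exact fun h => by linarith [h.2]

lemma lemA {a b : ℝ} (ha : a < 1/2) (hb : 1/2 < b) (n : ℕ) :
    ∀ x ∈ J a b, 0 < x → x < 1 → 1/2 ≤ 2^n * (1 - x) → ∃ y ∈ J a b, 0 < y ∧ y ≤ 1/2 := by
  induction n with
  | zero => intro x hx h0 h1 h; exact ⟨x, hx, h0, by norm_num at h; linarith⟩
  | succ n ih =>
    intro x hx h0 h1 h
    by_cases hle : x ≤ 1/2
    · exact ⟨x, hx, h0, hle⟩
    · have hD := ((J_iff hx.1).1 hx).2
      have e : Dbl x = 2*x-1 := by simp only [Dbl, if_neg hle]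
      rw [e] at hD
      push Not at hle
      refine ih _ hD (by linarith) (by linarith) ?_
      rw [pow_succ] at h
      linarith

lemma lemB {a b : ℝ} (ha : a < 1/2) (hb : 1/2 < b) (n : ℕ) :
    ∀ x ∈ J a b, 0 < x → x ≤ 1/2 → 1/4 ≤ 2^n * x →
      ∃ y ∈ J a b, y ∈ Set.Icc (1/4:ℝ) (1/2) := by
  induction n with
  | zero => intro x hx h0 h1 h; exact ⟨x, hx, by norm_num at h; linarith, h1⟩
  | succ n ih =>
    intro x hx h0 h1 h
    by_cases hle : 1/4 ≤ x
    · exact ⟨x, hx, hle, h1⟩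
    · have hD := ((J_iff hx.1).1 hx).2
      have e : Dbl x = 2*x := by simp only [Dbl, if_pos h1]
      rw [e] at hD
      push Not at hle
      refine ih _ hD (by linarith) (by linarith) ?_
      rw [pow_succ] at h
      linarith

lemma exists_core {a b : ℝ} (ha0 : 0 < a) (ha : a < 1/2) (hb : 1/2 < b) (hb1 : b ≤ 1)
    (h : J a b ≠ ({0, 1} : Set ℝ)) : ∃ y ∈ J a b, y ∈ Set.Icc (1/4:ℝ) (1/2) := by
  obtain ⟨x, hx, hx0, hx1⟩ : ∃ x ∈ J a b, x ≠ 0 ∧ x ≠ 1 := by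
    by_contra hc
    push Not at hc
    apply h
    ext x
    simp only [Set.mem_insert_iff, Set.mem_singleton_iff]
    constructor
    · intro hx
      by_cases h0 : x = 0
      · exact Or.inl h0
      · exact Or.inr (hc x hx h0)
    · rintro (rfl | rfl)
      · exact zero_mem_J ha0
      · exact one_mem_J hb1
  have h0 : 0 < x := lt_of_le_of_ne hx.1.1 (Ne.symm hx0)
  have h1 : x < 1 := lt_of_le_of_ne hx.1.2 hx1
  obtain ⟨n, hn⟩ := pow_unbounded_of_one_lt (1/(1-x)) (one_lt_two : (1:ℝ) < 2)
  rw [div_lt_iff₀ (by linarith)] at hn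
  obtain ⟨y, hy, hy0, hy1⟩ := lemA ha hb n x hx h0 h1 (by linarith)
  obtain ⟨m, hm⟩ := pow_unbounded_of_one_lt (1/y) (one_lt_two : (1:ℝ) < 2)
  rw [div_lt_iff₀ hy0] at hm
  exact lemB ha hb m y hy hy0 hy1 (by linarith)

lemma J_infinite {a b y : ℝ} (ha : a < 1/2) (hb : 1/2 < b) (hy : y ∈ J a b)
    (hy2 : y ∈ Set.Icc (1/4:ℝ) (1/2)) : (J a b).Infinite := by
  have hya : y ≤ a := by
    by_contra hc
    push Not at hc
    exact hy.2 0 ⟨hc, lt_of_le_of_lt hy2.2 hb⟩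
  have hy0 : 0 < y := by linarith [hy2.1]
  have key : ∀ m : ℕ, y / 2^m ∈ J a b ∧ 0 < y / 2^m ∧ y / 2^m ≤ a := by
    intro m
    induction m with
    | zero => simpa using ⟨hy, hy0, hya⟩
    | succ m ih =>
      obtain ⟨h1, h2, h3⟩ := ih
      have e : y / 2^(m+1) = y / 2^m / 2 := by rw [pow_succ, div_div]
      rw [e]
      generalize y / 2^m = z at *
      refine ⟨(J_iff ⟨by linarith, by linarith⟩).2 ⟨fun h => by linarith [h.1], ?_⟩,
        by linarith, by linarith⟩
      have : Dbl (z/2) = z := by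
        rw [Dbl, if_pos (by linarith)]; ring
      rwa [this]
  refine Set.infinite_of_injective_forall_mem (f := fun m : ℕ => y / 2^m) ?_ (fun m => (key m).1)
  intro m n hmn
  have h : y / 2^m = y / 2^n := hmn
  rw [div_eq_div_iff (by positivity) (by positivity)] at h
  replace h := (mul_left_cancel₀ hy0.ne' h).symm
  exact pow_right_injective₀ (by norm_num : (0:ℝ) < 2) (by norm_num) h

lemma J_closed {a b : ℝ} (ha : a < 1/2) (hb : 1/2 < b) : IsClosed (J a b) := by
  have key : ∀ n : ℕ, IsClosed {x ∈ Set.Icc (0:ℝ) 1 | ∀ i < n, Dbl^[i] x ∉ Set.Ioo a b} := by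
    intro n
    induction n with
    | zero =>
      convert (isClosed_Icc : IsClosed (Set.Icc (0:ℝ) 1)) using 1
      ext x
      simp
    | succ n ih =>
      have : {x ∈ Set.Icc (0:ℝ) 1 | ∀ i < n+1, Dbl^[i] x ∉ Set.Ioo a b} =
          (Set.Icc 0 1) ∩ ((Set.Iic a ∩ (fun x => 2*x) ⁻¹'
              {x ∈ Set.Icc (0:ℝ) 1 | ∀ i < n, Dbl^[i] x ∉ Set.Ioo a b}) ∪
            (Set.Ici b ∩ (fun x => 2*x-1) ⁻¹'
              {x ∈ Set.Icc (0:ℝ) 1 | ∀ i < n, Dbl^[i] x ∉ Set.Ioo a b})) := by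
        ext x
        have hL : x ≤ a → Dbl x = 2*x := fun h => by rw [Dbl, if_pos (by linarith)]
        have hR : b ≤ x → Dbl x = 2*x-1 := fun h => by rw [Dbl, if_neg (by linarith)]
        constructor
        · rintro ⟨hx, h⟩
          refine ⟨hx, ?_⟩
          have h' : Dbl x ∈ {x ∈ Set.Icc (0:ℝ) 1 | ∀ i < n, Dbl^[i] x ∉ Set.Ioo a b} :=
            ⟨Dbl_mem hx, fun i hi => by
              have := h (i+1) (by omega)
              rwa [Function.iterate_succ_apply] at this⟩
          by_cases hxa : x ≤ a
          · left
            rw [hL hxa] at h'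
            exact ⟨hxa, h'⟩
          · right
            have hxb : b ≤ x := by
              by_contra hc
              exact h 0 (by omega) ⟨not_le.1 hxa, not_le.1 hc⟩
            rw [hR hxb] at h'
            exact ⟨hxb, h'⟩
        · rintro ⟨hx, h⟩
          have h' : x ∉ Set.Ioo a b ∧
              Dbl x ∈ {x ∈ Set.Icc (0:ℝ) 1 | ∀ i < n, Dbl^[i] x ∉ Set.Ioo a b} := by
            rcases h with ⟨h1, h2⟩ | ⟨h1, h2⟩
            · rw [hL h1]
              exact ⟨fun h => absurd h.1 (not_lt.2 h1), h2⟩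
            · rw [hR h1]
              exact ⟨fun h => absurd h.2 (not_lt.2 h1), h2⟩
          refine ⟨hx, fun i hi => ?_⟩
          cases i with
          | zero => exact h'.1
          | succ i =>
            rw [Function.iterate_succ_apply]
            exact h'.2.2 i (by omega)
      rw [this]
      exact isClosed_Icc.inter ((isClosed_Iic.inter (ih.preimage (by fun_prop))).union
        (isClosed_Ici.inter (ih.preimage (by fun_prop))))
  have : J a b = ⋂ n : ℕ, {x ∈ Set.Icc (0:ℝ) 1 | ∀ i < n, Dbl^[i] x ∉ Set.Ioo a b} := by
    ext x
    simp only [Set.mem_iInter]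
    exact ⟨fun h n => ⟨h.1, fun i _ => h.2 i⟩,
      fun h => ⟨(h 0).1, fun n => (h (n+1)).2 n (by omega)⟩⟩
  rw [this]
  exact isClosed_iInter key

lemma exists_good {a : ℝ} (ha : 1/4 < a) (ha2 : a < 1/2) :
    ∃ b, 1/2 < b ∧ b < 1 ∧ J a b ≠ ({0, 1} : Set ℝ) := by
  obtain ⟨N, hN⟩ := pow_unbounded_of_one_lt (4 * a/(a-1/4)) (one_lt_two : (1:ℝ) < 2)
  rw [div_lt_iff₀ (by linarith)] at hN
  set M : ℝ := 2^N with hM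
  have hM4 : 4 < M := by nlinarith
  have hd : 0 < M - 1 := by linarith
  have hN0 : N ≠ 0 := by
    rintro rfl
    norm_num [hM] at hM4
  have inv : ∀ n : ℕ, ∃ k < N, Dbl^[n] (1/(M-1)) = 2^k/(M-1) := by
    intro n
    induction n with
    | zero => exact ⟨0, by omega, by simp⟩
    | succ n ih =>
      obtain ⟨k, hk, e⟩ := ih
      rw [Function.iterate_succ_apply', e]
      by_cases hk1 : k + 1 < N
      · refine ⟨k+1, hk1, ?_⟩
        have h2 : (2:ℝ)^(k+2) ≤ M := pow_le_pow_right₀ (by norm_num) (by omega)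
        rw [pow_add] at h2
        rw [Dbl, if_pos, pow_succ]
        · ring
        · rw [div_le_iff₀ hd]; linarith
      · refine ⟨0, by omega, ?_⟩
        have h2 : M = 2^k * 2 := by rw [hM, ← pow_succ]; congr 1; omega
        rw [Dbl, if_neg]
        · field_simp; linarith
        · rw [not_le, lt_div_iff₀ hd]; linarith
  refine ⟨M/2/(M-1), ?_, ?_, ?_⟩
  · rw [lt_div_iff₀ hd]; linarith
  · rw [div_lt_iff₀ hd]; linarith
  · intro h
    have hm : 1/(M-1) ∈ J a (M/2/(M-1)) := by
      refine ⟨⟨by positivity, ?_⟩, fun n hn => ?_⟩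
      · rw [div_le_iff₀ hd]; linarith
      · obtain ⟨k, hk, e⟩ := inv n
        rw [e] at hn
        obtain ⟨h1, h2⟩ := hn
        rw [lt_div_iff₀ hd] at h1
        rw [div_lt_div_iff_of_pos_right hd] at h2
        by_cases hk1 : k + 1 < N
        · have h3 : (2:ℝ)^(k+2) ≤ M := pow_le_pow_right₀ (by norm_num) (by omega)
          rw [pow_add] at h3
          nlinarith
        · have h3 : M = 2^k * 2 := by rw [hM, ← pow_succ]; congr 1; omega
          linarith
    rw [h] at hm
    rcases hm with hm | hm
    · have : 0 < 1/(M-1) := by positivity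
      linarith
    · rw [Set.mem_singleton_iff, div_eq_iff hd.ne'] at hm
      linarith

lemma phi_core {a : ℝ} (ha : 1/4 < a) (ha2 : a < 1/2) :
    1/2 < phi a ∧ ∃ y ∈ J a (phi a), y ∈ Set.Icc (1/4:ℝ) (1/2) := by
  obtain ⟨b0, h0, h1, hJ⟩ := exists_good ha ha2
  have hbdd : BddAbove {b | b ∈ Set.Ioo a 1 ∧ J a b ≠ ({0, 1} : Set ℝ)} :=
    ⟨1, fun b hb => hb.1.2.le⟩
  have hb0 : b0 ∈ {b | b ∈ Set.Ioo a 1 ∧ J a b ≠ ({0, 1} : Set ℝ)} := ⟨⟨by linarith, h1⟩, hJ⟩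
  have hphi : b0 ≤ phi a := le_csSup hbdd hb0
  refine ⟨by linarith, ?_⟩
  let S := {b // 1/2 < b ∧ b ∈ Set.Ioo a 1 ∧ J a b ≠ ({0, 1} : Set ℝ)}
  haveI : Nonempty S := ⟨⟨b0, h0, hb0⟩⟩
  have hne := IsCompact.nonempty_iInter_of_directed_nonempty_isCompact_isClosed
    (fun s : S => J a s.1 ∩ Set.Icc (1/4:ℝ) (1/2)) (by
      intro s t
      rcases le_total s.1 t.1 with h | h
      · exact ⟨t, Set.inter_subset_inter_left _ (J_anti h), subset_rfl⟩
      · exact ⟨s, subset_rfl, Set.inter_subset_inter_left _ (J_anti h)⟩)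
    (fun s => exists_core (by linarith) ha2 s.2.1 s.2.2.1.2.le s.2.2.2)
    (fun s => isCompact_Icc.inter_left (J_closed ha2 s.2.1))
    (fun s => (J_closed ha2 s.2.1).inter isClosed_Icc)
  obtain ⟨y, hy⟩ := hne
  rw [Set.mem_iInter] at hy
  refine ⟨y, ⟨(hy ⟨b0, h0, hb0⟩).1.1, fun n hn => ?_⟩, (hy ⟨b0, h0, hb0⟩).2⟩
  obtain ⟨c, hc, hlt⟩ := exists_lt_of_lt_csSup ⟨b0, hb0⟩ hn.2
  rcases le_total b0 c with h | h
  · exact (hy ⟨c, by linarith, hc⟩).1.2 n ⟨hn.1, hlt⟩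
  · exact (hy ⟨b0, h0, hb0⟩).1.2 n ⟨hn.1, lt_of_lt_of_le hlt h⟩

theorem stmt4 (a b : ℝ) (ha : a ∈ Set.Ioo (1/4:ℝ) (1/2)) (hb : b ∈ Set.Ioo (1/2:ℝ) (3/4)) :
    (J a b ≠ ({0, 1} : Set ℝ) ↔ b ≤ phi a) ∧ (J a (phi a)).Infinite := by
  obtain ⟨ha1, ha2⟩ := ha
  obtain ⟨hb1, hb2⟩ := hb
  obtain ⟨hp, y, hy, hy2⟩ := phi_core ha1 ha2
  have hinf := J_infinite ha2 hp hy hy2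
  refine ⟨⟨fun h => le_csSup ⟨1, fun b hb => hb.1.2.le⟩ ⟨⟨by linarith, by linarith⟩, h⟩,
    fun h he => ?_⟩, hinf⟩
  have h2 := hinf.mono (J_anti h)
  rw [he] at h2
  exact h2 (Set.toFinite _)


end
end
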